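/- arXiv:1309.0055 — 3 statements merged into one kernel-verified Lean document; each statement's English description precedes it below -/
import Mathlib

section
/- The function t ↦ log Φ(√t) is strictly concave for t > 0; that is, (d²/dt²) log Φ(√t) < 0 for all t > 0. Equivalently, t·(Φ′(t)² − Φ(t)Φ″(t)) + Φ(t)Φ′(t) > 0 for all t > 0. -/
/-- The Jacobi theta kernel `Φ(t) := ∑_{n=1}^∞ π n² (2π n² e^{4t} − 3)·exp(5t − π n² e^{4t})`. -/
noncomputable def jacobiPhi (t : ℝ) : ℝ :=
  ∑' n : ℕ, Real.pi * ((n : ℝ) + 1) ^ 2 *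
    (2 * Real.pi * ((n : ℝ) + 1) ^ 2 * Real.exp (4 * t) - 3) *
    Real.exp (5 * t - Real.pi * ((n : ℝ) + 1) ^ 2 * Real.exp (4 * t))


namespace JP

open Real

/-- Generic exponential series. -/
noncomputable def S (a b : ℕ → ℝ) (y : ℝ) : ℝ := ∑' n, b n * Real.exp (-(a n * y))

/-- Growth conditions. -/
def Adm (a b : ℕ → ℝ) : Prop :=
  (∀ n : ℕ, (n : ℝ) ≤ a n) ∧ (∀ n : ℕ, a n ≤ ((n : ℝ) + 2) ^ 2) ∧
    ∃ k : ℕ, ∀ n : ℕ, |b n| ≤ ((n : ℝ) + 2) ^ k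

lemma summable_base (k : ℕ) {y : ℝ} (hy : 0 < y) :
    Summable (fun n : ℕ => ((n : ℝ) + 2) ^ k * Real.exp (-(n * y))) := by
  have h := (summable_nat_add_iff 2).2 (Real.summable_pow_mul_exp_neg_nat_mul k hy)
  have h2 := h.mul_left (Real.exp (2 * y))
  refine h2.congr (fun n => ?_)
  push_cast
  rw [mul_left_comm, ← Real.exp_add]
  congr 2
  ring

lemma Adm.bound {a b : ℕ → ℝ} {k : ℕ} (ha : ∀ n : ℕ, (n : ℝ) ≤ a n)
    (hb : ∀ n : ℕ, |b n| ≤ ((n : ℝ) + 2) ^ k) {y z : ℝ} (hz : 0 < z) (hzy : z ≤ y) (n : ℕ) :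
    ‖b n * Real.exp (-(a n * y))‖ ≤ ((n : ℝ) + 2) ^ k * Real.exp (-(n * z)) := by
  rw [norm_mul, Real.norm_eq_abs, Real.norm_eq_abs, abs_of_pos (Real.exp_pos _)]
  have h0 : (0 : ℝ) ≤ n := Nat.cast_nonneg n
  have : (n : ℝ) * z ≤ a n * y := mul_le_mul (ha n) hzy hz.le (h0.trans (ha n))
  exact mul_le_mul (hb n) (Real.exp_le_exp.2 (by linarith)) (Real.exp_pos _).le (by positivity)

lemma Adm.summable {a b : ℕ → ℝ} (h : Adm a b) {y : ℝ} (hy : 0 < y) :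
    Summable (fun n => b n * Real.exp (-(a n * y))) := by
  obtain ⟨ha, -, k, hb⟩ := h
  exact Summable.of_norm_bounded (summable_base k hy) (Adm.bound ha hb hy le_rfl)

lemma Adm.mul {a b : ℕ → ℝ} (h : Adm a b) : Adm a (fun n => b n * a n) := by
  obtain ⟨ha, ha2, k, hb⟩ := h
  refine ⟨ha, ha2, k + 2, fun n => ?_⟩
  have h0 : (0 : ℝ) ≤ n := Nat.cast_nonneg n
  rw [abs_mul, abs_of_nonneg (h0.trans (ha n)), pow_add]
  exact mul_le_mul (hb n) (ha2 n) (h0.trans (ha n)) (by positivity)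

lemma Adm.hasDerivAt {a b : ℕ → ℝ} (h : Adm a b) {y : ℝ} (hy : 0 < y) :
    HasDerivAt (S a b) (-(S a (fun n => b n * a n) y)) y := by
  obtain ⟨ha, -, k, hb⟩ := h.mul
  have key := hasDerivAt_tsum_of_isPreconnected (t := Set.Ioi (y / 2)) (y₀ := y) (y := y)
    (g := fun n z => b n * Real.exp (-(a n * z)))
    (g' := fun n z => -(b n * a n * Real.exp (-(a n * z))))
    (summable_base k (half_pos hy)) isOpen_Ioi isPreconnected_Ioi
    (fun n z hz => by
      have h1 : HasDerivAt (fun z : ℝ => -(a n * z)) (-(a n * 1)) z :=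
        ((hasDerivAt_id z).const_mul (a n)).neg
      exact ((h1.exp).const_mul (b n)).congr_deriv (by ring))
    (fun n z hz => by
      rw [norm_neg]
      exact Adm.bound ha hb (half_pos hy) (le_of_lt hz) n)
    (by simp [hy]) (h.summable hy) (by simp [hy])
  rw [tsum_neg] at key
  exact key

/-! ### Evenness -/

/-- the theta-type sums `∑ N^{2j} e^{-N² y}` -/
noncomputable def T (j : ℕ) (y : ℝ) : ℝ :=
  S (fun n => ((n : ℝ) + 1) ^ 2) (fun n => (((n : ℝ) + 1) ^ 2) ^ j) y

lemma admT (j : ℕ) : Adm (fun n => ((n : ℝ) + 1) ^ 2) (fun n => (((n : ℝ) + 1) ^ 2) ^ j) := by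
  refine ⟨fun n => ?_, fun n => ?_, 2 * j, fun n => ?_⟩
  · have h0 : (0 : ℝ) ≤ n := Nat.cast_nonneg n
    nlinarith
  · have h0 : (0 : ℝ) ≤ n := Nat.cast_nonneg n
    nlinarith
  · have h0 : (0 : ℝ) ≤ n := Nat.cast_nonneg n
    rw [abs_of_nonneg (by positivity)]
    change (((n : ℝ) + 1) ^ 2) ^ j ≤ _
    rw [← pow_mul]
    exact pow_le_pow_left₀ (by positivity) (by linarith) _

lemma hasDerivAt_T (j : ℕ) {y : ℝ} (hy : 0 < y) : HasDerivAt (T j) (-(T (j + 1) y)) y := by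
  have := (admT j).hasDerivAt hy
  unfold T
  simp only [pow_succ _ j]
  exact this

lemma theta_eq {x : ℝ} (hx : 0 < x) :
    ∑' n : ℤ, Real.exp (-π * x * (n : ℝ) ^ 2) = 1 + 2 * T 0 (π * x) := by
  have hs := (admT 0).summable (mul_pos pi_pos hx)
  simp only [pow_zero, one_mul] at hs
  have e : ∀ n : ℕ, Real.exp (-π * x * (((n : ℤ) + 1 : ℤ) : ℝ) ^ 2)
      = Real.exp (-(((n : ℝ) + 1) ^ 2 * (π * x))) := fun n => by push_cast; congr 1; ring
  have h1 : HasSum (fun n : ℕ => Real.exp (-π * x * (((n : ℤ) + 1 : ℤ) : ℝ) ^ 2))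
      (T 0 (π * x)) := by
    have := hs.hasSum
    simp only [e, T, S, pow_zero, one_mul]
    exact this
  have h2 := HasSum.of_add_one_of_neg_add_one (f := fun n : ℤ => Real.exp (-π * x * (n : ℝ) ^ 2))
    (m := T 0 (π * x)) (m' := T 0 (π * x)) (by simpa using h1)
    (by
      have : ∀ n : ℕ, Real.exp (-π * x * ((-((n : ℤ) + 1) : ℤ) : ℝ) ^ 2)
        = Real.exp (-π * x * (((n : ℤ) + 1 : ℤ) : ℝ) ^ 2) := fun n => by push_cast; congr 1; ring
      simp only [this]; exact h1)
  rw [h2.tsum_eq]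
  simp
  ring

/-- `e^t θ(e^{4t})`. -/
noncomputable def G (t : ℝ) : ℝ := Real.exp t * (1 + 2 * T 0 (π * Real.exp (4 * t)))

lemma G_even (t : ℝ) : G (-t) = G t := by
  have h := Real.tsum_exp_neg_mul_int_sq (Real.exp_pos (4 * t))
  have e : ∀ n : ℤ, Real.exp (-π / Real.exp (4 * t) * (n : ℝ) ^ 2)
      = Real.exp (-π * Real.exp (4 * -t) * (n : ℝ) ^ 2) := fun n => by
    rw [mul_neg, Real.exp_neg]; congr 1
  simp only [e] at h
  rw [theta_eq (Real.exp_pos _), theta_eq (Real.exp_pos _)] at h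
  unfold G
  rw [h, ← Real.exp_mul]
  have h3 : Real.exp (4 * t * (1 / 2)) = Real.exp t * Real.exp t := by
    rw [← Real.exp_add]; congr 1; ring
  rw [h3, Real.exp_neg]
  have := (Real.exp_pos t).ne'
  field_simp

lemma hasDerivAt_yt (t : ℝ) : HasDerivAt (fun t => π * Real.exp (4 * t))
    (4 * (π * Real.exp (4 * t))) t := by
  have h1 : HasDerivAt (fun t : ℝ => 4 * t) (4 * 1) t := (hasDerivAt_id t).const_mul 4
  exact (h1.exp.const_mul π).congr_deriv (by ring)

lemma yt_pos (t : ℝ) : 0 < π * Real.exp (4 * t) := by positivity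

lemma hasDerivAt_Tt (j : ℕ) (t : ℝ) : HasDerivAt (fun t => T j (π * Real.exp (4 * t)))
    (-(T (j + 1) (π * Real.exp (4 * t))) * (4 * (π * Real.exp (4 * t)))) t :=
  (hasDerivAt_T j (yt_pos t)).comp t (hasDerivAt_yt t)

noncomputable def G1 (t : ℝ) : ℝ := Real.exp t * (1 + 2 * T 0 (π * Real.exp (4 * t))) +
   Real.exp t * (-8 * (π * Real.exp (4 * t) * T 1 (π * Real.exp (4 * t))))

lemma hasDerivAt_G (t : ℝ) : HasDerivAt G (G1 t) t := by
  have h := (Real.hasDerivAt_exp t).mul (((hasDerivAt_Tt 0 t).const_mul 2).const_add 1)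
  exact h.congr_deriv (by unfold G1; ring)

lemma jacobiPhi_T (t : ℝ) : jacobiPhi t = π * Real.exp (5 * t) *
    (2 * (π * Real.exp (4 * t)) * T 2 (π * Real.exp (4 * t)) - 3 * T 1 (π * Real.exp (4 * t))) := by
  have h1 := ((admT 1).summable (yt_pos t)).hasSum.mul_left 3
  have h2 := ((admT 2).summable (yt_pos t)).hasSum.mul_left (2 * (π * Real.exp (4 * t)))
  have h3 := (h2.sub h1).mul_left (π * Real.exp (5 * t))
  unfold T S
  rw [← h3.tsum_eq, jacobiPhi]
  refine tsum_congr (fun n => ?_)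
  rw [sub_eq_add_neg (5 * t), Real.exp_add]
  have : -(π * ((n : ℝ) + 1) ^ 2 * Real.exp (4 * t))
    = -(((n : ℝ) + 1) ^ 2 * (π * Real.exp (4 * t))) := by ring
  rw [this]
  ring

lemma hasDerivAt_G1 (t : ℝ) : HasDerivAt G1 (G t + 16 * jacobiPhi t) t := by
  have h := ((Real.hasDerivAt_exp t).mul (((hasDerivAt_Tt 0 t).const_mul 2).const_add 1)).add
    ((Real.hasDerivAt_exp t).mul (((hasDerivAt_yt t).mul (hasDerivAt_Tt 1 t)).const_mul (-8)))
  refine h.congr_deriv ?_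
  rw [jacobiPhi_T]
  have : Real.exp (5 * t) = Real.exp t * Real.exp (4 * t) := by
    rw [← Real.exp_add]; congr 1; ring
  rw [this]
  unfold G
  simp only [Pi.mul_apply]
  ring

lemma deriv_odd {f : ℝ → ℝ} (h : ∀ t, f (-t) = f t) (t : ℝ) : deriv f (-t) = -deriv f t := by
  have h1 := deriv_comp_neg f t
  have h2 : (fun x => f (-x)) = f := funext h
  rw [h2] at h1
  linarith

lemma deriv_even {f : ℝ → ℝ} (h : ∀ t, f (-t) = -f t) (t : ℝ) : deriv f (-t) = deriv f t := by
  have h1 := deriv_comp_neg f t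
  have h2 : (fun x => f (-x)) = fun x => -f x := funext h
  rw [h2, deriv.fun_neg] at h1
  linarith

lemma jacobiPhi_even (t : ℝ) : jacobiPhi (-t) = jacobiPhi t := by
  have e1 : deriv G = G1 := funext fun t => (hasDerivAt_G t).deriv
  have e2 := deriv_even (deriv_odd G_even) t
  rw [e1, (hasDerivAt_G1 _).deriv, (hasDerivAt_G1 _).deriv, G_even] at e2
  linarith

/-! ### The remainder series -/

/-- exponents `N²-1`, `N ≥ 2` -/
noncomputable def av (n : ℕ) : ℝ := ((n : ℝ) + 2) ^ 2 - 1

/-- `∑_{N≥2} N² (N²-1)^j e^{-(N²-1)y}` -/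
noncomputable def W (j : ℕ) (y : ℝ) : ℝ := S av (fun n => (av n + 1) * av n ^ j) y

lemma av_ge (n : ℕ) : 3 ≤ av n := by
  have h0 : (0 : ℝ) ≤ n := Nat.cast_nonneg n
  unfold av; nlinarith

lemma admW (j : ℕ) : Adm av (fun n => (av n + 1) * av n ^ j) := by
  induction j with
  | zero =>
    refine ⟨fun n => ?_, fun n => ?_, 2, fun n => ?_⟩
    · have h0 : (0 : ℝ) ≤ n := Nat.cast_nonneg n
      unfold av; nlinarith
    · unfold av; linarith
    · have := av_ge n
      rw [abs_of_nonneg (by positivity)]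
      simp [av]
  | succ j ih =>
    have := ih.mul
    simpa only [pow_succ, mul_assoc] using this

lemma hasDerivAt_W (j : ℕ) {y : ℝ} (hy : 0 < y) : HasDerivAt (W j) (-(W (j + 1) y)) y := by
  have := (admW j).hasDerivAt hy
  unfold W
  simp only [pow_succ _ j, ← mul_assoc]
  exact this

lemma hasSum_W (j : ℕ) {y : ℝ} (hy : 0 < y) :
    HasSum (fun n => (av n + 1) * av n ^ j * Real.exp (-(av n * y))) (W j y) :=
  ((admW j).summable hy).hasSum

lemma W_nonneg (j : ℕ) {y : ℝ} (hy : 0 < y) : 0 ≤ W j y :=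
  (hasSum_W j hy).nonneg (fun n => by have := av_ge n; positivity)

lemma W_succ_ge (j : ℕ) {y : ℝ} (hy : 0 < y) : 3 * W j y ≤ W (j + 1) y := by
  refine hasSum_le (fun n => ?_) ((hasSum_W j hy).mul_left 3) (hasSum_W (j + 1) hy)
  have := av_ge n
  rw [pow_succ]
  have h : 0 ≤ (av n + 1) * av n ^ j * Real.exp (-(av n * y)) := by positivity
  nlinarith

lemma T_eq (j : ℕ) {y : ℝ} (hy : 0 < y) :
    T j y = Real.exp (-y) * (1 + ∑' n, (av n + 1) ^ j * Real.exp (-(av n * y))) := by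
  have hs := (admT j).summable hy
  unfold T S
  rw [hs.tsum_eq_zero_add, mul_add, ← tsum_mul_left]
  congr 1
  · simp
  · refine tsum_congr (fun n => ?_)
    rw [mul_left_comm, ← Real.exp_add]
    unfold av
    push_cast
    congr 2 <;> ring

lemma T1_eq {y : ℝ} (hy : 0 < y) : T 1 y = Real.exp (-y) * (1 + W 0 y) := by
  rw [T_eq 1 hy, ← (hasSum_W 0 hy).tsum_eq]
  simp

lemma T2_eq {y : ℝ} (hy : 0 < y) : T 2 y = Real.exp (-y) * (1 + (W 0 y + W 1 y)) := by
  rw [T_eq 2 hy, ← ((hasSum_W 0 hy).add (hasSum_W 1 hy)).tsum_eq]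
  congr 3
  funext n
  ring

/-! ### The chain of derivatives in the variable `s = 4t` -/

noncomputable def Y (s : ℝ) : ℝ := π * Real.exp s
noncomputable def w (s : ℝ) : ℝ := 1 / (2 * Y s - 3)
noncomputable def V (j : ℕ) (s : ℝ) : ℝ := W j (Y s)

lemma Y_pos (s : ℝ) : 0 < Y s := by unfold Y; positivity

lemma dY (s : ℝ) : HasDerivAt Y (Y s) s := (Real.hasDerivAt_exp s).const_mul π

lemma dV (j : ℕ) (s : ℝ) : HasDerivAt (V j) (-(Y s * V (j + 1) s)) s :=
  ((hasDerivAt_W j (Y_pos s)).comp s (dY s)).congr_deriv (by unfold V; ring)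

/-- region of validity -/
def Dom (s : ℝ) : Prop := 3 < 2 * Y s

lemma Dom.w_pos {s : ℝ} (h : Dom s) : 0 < w s := by
  unfold Dom at h; unfold w
  have : 0 < 2 * Y s - 3 := by linarith
  positivity

lemma Dom.Yw {s : ℝ} (h : Dom s) : 2 * Y s * w s = 1 + 3 * w s := by
  unfold Dom at h
  have : 2 * Y s - 3 ≠ 0 := by linarith
  unfold w
  field_simp
  ring

lemma dw {s : ℝ} (h : Dom s) : HasDerivAt w (-(w s + 3 * w s ^ 2)) s := by
  have h1 : HasDerivAt (fun s => 2 * Y s - 3) (2 * Y s) s := ((dY s).const_mul 2).sub_const 3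
  have h0 : 2 * Y s - 3 ≠ 0 := by unfold Dom at h; linarith
  have h2 := h1.inv h0
  have e : w = (fun s => 2 * Y s - 3)⁻¹ := by funext s; simp [w]
  rw [e]
  refine h2.congr_deriv ?_
  simp only [Pi.inv_apply]
  field_simp
  ring

lemma Dom.open_nhds {s : ℝ} (h : Dom s) : ∀ᶠ x in nhds s, Dom x := by
  have : ContinuousAt (fun x => 2 * Y x) s := ((dY s).const_mul 2).continuousAt
  exact this.eventually_const_lt h

lemma Dom.of_nonneg {s : ℝ} (h : 0 ≤ s) : Dom s := by
  unfold Dom Y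
  have h1 := Real.one_le_exp h
  have := Real.pi_gt_three
  nlinarith

noncomputable def V1 (j : ℕ) (s : ℝ) : ℝ := -(Y s * V (j + 1) s)
noncomputable def V2 (j : ℕ) (s : ℝ) : ℝ := Y s ^ 2 * V (j + 2) s - Y s * V (j + 1) s
noncomputable def V3 (j : ℕ) (s : ℝ) : ℝ :=
  -(Y s ^ 3 * V (j + 3) s - 3 * Y s ^ 2 * V (j + 2) s + Y s * V (j + 1) s)
noncomputable def V4 (j : ℕ) (s : ℝ) : ℝ :=
  Y s ^ 4 * V (j + 4) s - 6 * Y s ^ 3 * V (j + 3) s + 7 * Y s ^ 2 * V (j + 2) s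
    - Y s * V (j + 1) s

lemma dV1 (j : ℕ) (s : ℝ) : HasDerivAt (V1 j) (V2 j s) s :=
  ((dY s).fun_mul (dV (j + 1) s)).fun_neg.congr_deriv (by unfold V2; ring)

lemma dV2 (j : ℕ) (s : ℝ) : HasDerivAt (V2 j) (V3 j s) s :=
  ((((dY s).fun_pow 2).fun_mul (dV (j + 2) s)).fun_sub
    ((dY s).fun_mul (dV (j + 1) s))).congr_deriv (by unfold V3; push_cast; ring)

lemma dV3 (j : ℕ) (s : ℝ) : HasDerivAt (V3 j) (V4 j s) s :=
  (((((dY s).fun_pow 3).fun_mul (dV (j + 3) s)).fun_sub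
    ((((dY s).fun_pow 2).const_mul 3).fun_mul (dV (j + 2) s))).fun_add
    ((dY s).fun_mul (dV (j + 1) s))).fun_neg.congr_deriv (by unfold V4; push_cast; ring)

noncomputable def c0 (s : ℝ) : ℝ := 1 + 3 * w s
noncomputable def c1 (s : ℝ) : ℝ := -(3 * w s + 9 * w s ^ 2)
noncomputable def c2 (s : ℝ) : ℝ := 3 * w s + 27 * w s ^ 2 + 54 * w s ^ 3
noncomputable def c3 (s : ℝ) : ℝ := -(3 * w s + 63 * w s ^ 2 + 324 * w s ^ 3 + 486 * w s ^ 4)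
noncomputable def c4 (s : ℝ) : ℝ :=
  3 * w s + 135 * w s ^ 2 + 1350 * w s ^ 3 + 4860 * w s ^ 4 + 5832 * w s ^ 5

lemma dc0 {s : ℝ} (h : Dom s) : HasDerivAt c0 (c1 s) s :=
  (((dw h).const_mul 3).const_add 1).congr_deriv (by unfold c1; ring)
lemma dc1 {s : ℝ} (h : Dom s) : HasDerivAt c1 (c2 s) s :=
  (((dw h).const_mul 3).fun_add (((dw h).fun_pow 2).const_mul 9)).fun_neg.congr_deriv
    (by unfold c2; push_cast; ring)
lemma dc2 {s : ℝ} (h : Dom s) : HasDerivAt c2 (c3 s) s :=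
  ((((dw h).const_mul 3).fun_add (((dw h).fun_pow 2).const_mul 27)).fun_add
    (((dw h).fun_pow 3).const_mul 54)).congr_deriv
    (by unfold c3; push_cast; ring)
lemma dc3 {s : ℝ} (h : Dom s) : HasDerivAt c3 (c4 s) s :=
  (((((dw h).const_mul 3).fun_add (((dw h).fun_pow 2).const_mul 63)).fun_add
    (((dw h).fun_pow 3).const_mul 324)).fun_add
    (((dw h).fun_pow 4).const_mul 486)).fun_neg.congr_deriv
    (by unfold c4; push_cast; ring)

noncomputable def r0 (s : ℝ) : ℝ := V 0 s + c0 s * V 1 s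
noncomputable def r1 (s : ℝ) : ℝ := V1 0 s + (c1 s * V 1 s + c0 s * V1 1 s)
noncomputable def r2 (s : ℝ) : ℝ :=
  V2 0 s + (c2 s * V 1 s + 2 * c1 s * V1 1 s + c0 s * V2 1 s)
noncomputable def r3 (s : ℝ) : ℝ :=
  V3 0 s + (c3 s * V 1 s + 3 * c2 s * V1 1 s + 3 * c1 s * V2 1 s + c0 s * V3 1 s)
noncomputable def r4 (s : ℝ) : ℝ :=
  V4 0 s + (c4 s * V 1 s + 4 * c3 s * V1 1 s + 6 * c2 s * V2 1 s + 4 * c1 s * V3 1 s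
    + c0 s * V4 1 s)

lemma dV0 (j : ℕ) (s : ℝ) : HasDerivAt (V j) (V1 j s) s := dV j s

lemma dr0 {s : ℝ} (h : Dom s) : HasDerivAt r0 (r1 s) s :=
  ((dV0 0 s).fun_add ((dc0 h).fun_mul (dV0 1 s))).congr_deriv (by unfold r1; ring)
lemma dr1 {s : ℝ} (h : Dom s) : HasDerivAt r1 (r2 s) s :=
  ((dV1 0 s).fun_add (((dc1 h).fun_mul (dV0 1 s)).fun_add
    ((dc0 h).fun_mul (dV1 1 s)))).congr_deriv (by unfold r2; ring)
lemma dr2 {s : ℝ} (h : Dom s) : HasDerivAt r2 (r3 s) s :=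
  ((dV2 0 s).fun_add ((((dc2 h).fun_mul (dV0 1 s)).fun_add
    (((dc1 h).const_mul 2).fun_mul (dV1 1 s))).fun_add
    ((dc0 h).fun_mul (dV2 1 s)))).congr_deriv (by unfold r3; ring)
lemma dr3 {s : ℝ} (h : Dom s) : HasDerivAt r3 (r4 s) s :=
  ((dV3 0 s).fun_add (((((dc3 h).fun_mul (dV0 1 s)).fun_add
    (((dc2 h).const_mul 3).fun_mul (dV1 1 s))).fun_add
    (((dc1 h).const_mul 3).fun_mul (dV2 1 s))).fun_add
    ((dc0 h).fun_mul (dV3 1 s)))).congr_deriv (by unfold r4; ring)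

lemma V_nonneg (j : ℕ) (s : ℝ) : 0 ≤ V j s := W_nonneg j (Y_pos s)

lemma Dom.r0_nonneg {s : ℝ} (h : Dom s) : 0 ≤ r0 s := by
  have h1 := V_nonneg 0 s
  have h2 := V_nonneg 1 s
  have h3 := h.w_pos
  unfold r0 c0
  positivity

noncomputable def u (s : ℝ) : ℝ := 1 / (1 + r0 s)

lemma du {s : ℝ} (h : Dom s) : HasDerivAt u (-(r1 s * u s ^ 2)) s := by
  have h1 : HasDerivAt (fun s => 1 + r0 s) (r1 s) s := (dr0 h).const_add 1
  have h0 : 1 + r0 s ≠ 0 := by have := h.r0_nonneg; linarith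
  have h2 := h1.inv h0
  have e : u = (fun s => 1 + r0 s)⁻¹ := by funext s; simp [u]
  rw [e]
  refine h2.congr_deriv ?_
  simp only [Pi.inv_apply]
  field_simp

noncomputable def N0 (s : ℝ) : ℝ :=
  Real.log π + 5 / 4 * s - Y s + Real.log (2 * Y s - 3) + Real.log (1 + r0 s)
noncomputable def N1 (s : ℝ) : ℝ := 5 / 4 - Y s + c0 s + r1 s * u s
noncomputable def N2 (s : ℝ) : ℝ := -Y s + c1 s + (r2 s * u s - r1 s ^ 2 * u s ^ 2)
noncomputable def N3 (s : ℝ) : ℝ :=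
  -Y s + c2 s + (r3 s * u s - 3 * (r1 s * r2 s) * u s ^ 2 + 2 * r1 s ^ 3 * u s ^ 3)
noncomputable def N4 (s : ℝ) : ℝ :=
  -Y s + c3 s + (r4 s * u s - 4 * r1 s * r3 s * u s ^ 2 - 3 * r2 s ^ 2 * u s ^ 2
    + 12 * r1 s ^ 2 * r2 s * u s ^ 3 - 6 * r1 s ^ 4 * u s ^ 4)

lemma dN0 {s : ℝ} (h : Dom s) : HasDerivAt N0 (N1 s) s := by
  have h1 : HasDerivAt (fun s => 1 + r0 s) (r1 s) s := (dr0 h).const_add 1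
  have h0 : 1 + r0 s ≠ 0 := by have := h.r0_nonneg; linarith
  have h2 : HasDerivAt (fun s => 2 * Y s - 3) (2 * Y s) s := ((dY s).const_mul 2).sub_const 3
  have h3 : 2 * Y s - 3 ≠ 0 := by unfold Dom at h; linarith
  have h4 : HasDerivAt (fun s => Real.log π + 5 / 4 * s) (5 / 4 * 1) s :=
    ((hasDerivAt_id s).const_mul (5 / 4)).const_add _
  refine (((h4.fun_sub (dY s)).fun_add (h2.log h3)).fun_add (h1.log h0)).congr_deriv ?_
  have : 2 * Y s / (2 * Y s - 3) = c0 s := by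
    unfold c0; rw [← h.Yw]; unfold w; ring
  rw [this]
  unfold N1 u
  ring

lemma dN1 {s : ℝ} (h : Dom s) : HasDerivAt N1 (N2 s) s :=
  ((((dY s).const_sub (5 / 4)).fun_add (dc0 h)).fun_add ((dr1 h).fun_mul (du h))).congr_deriv
    (by unfold N2; ring)

lemma dN2 {s : ℝ} (h : Dom s) : HasDerivAt N2 (N3 s) s :=
  (((dY s).fun_neg.fun_add (dc1 h)).fun_add (((dr2 h).fun_mul (du h)).fun_sub
    (((dr1 h).fun_pow 2).fun_mul ((du h).fun_pow 2)))).congr_deriv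
    (by unfold N3; push_cast; ring)

lemma dN3 {s : ℝ} (h : Dom s) : HasDerivAt N3 (N4 s) s :=
  (((dY s).fun_neg.fun_add (dc2 h)).fun_add ((((dr3 h).fun_mul (du h)).fun_sub
    ((((dr1 h).fun_mul (dr2 h)).const_mul 3).fun_mul ((du h).fun_pow 2))).fun_add
    ((((dr1 h).fun_pow 3).const_mul 2).fun_mul ((du h).fun_pow 3)))).congr_deriv
    (by unfold N4; push_cast; ring)

lemma jacobiPhi_eq {t : ℝ} (h : Dom (4 * t)) : jacobiPhi t = Real.exp (N0 (4 * t)) := by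
  have hr := h.r0_nonneg
  have hY := Y_pos (4 * t)
  have hd : 0 < 2 * Y (4 * t) - 3 := by unfold Dom at h; linarith
  unfold N0
  rw [Real.exp_add, Real.exp_add, Real.exp_sub, Real.exp_add, Real.exp_log pi_pos,
    Real.exp_log hd, Real.exp_log (by linarith), jacobiPhi_T]
  change π * Real.exp (5 * t) * (2 * Y (4 * t) * T 2 (Y (4 * t)) - 3 * T 1 (Y (4 * t))) = _
  rw [T1_eq hY, T2_eq hY, Real.exp_neg]
  have e : (5 : ℝ) / 4 * (4 * t) = 5 * t := by ring
  rw [e]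
  have h2 : (2 * Y (4 * t) - 3) * c0 (4 * t) = 2 * Y (4 * t) := by
    unfold c0; rw [← h.Yw]; unfold w; field_simp
  have h3 : (2 * Y (4 * t) - 3) * (1 + r0 (4 * t)) = (2 * Y (4 * t) - 3) * (1 + V 0 (4 * t))
      + 2 * Y (4 * t) * V 1 (4 * t) := by
    unfold r0; linear_combination V 1 (4 * t) * h2
  rw [mul_assoc _ (2 * Y (4 * t) - 3), h3]
  unfold V
  have := (Real.exp_pos (Y (4 * t))).ne'
  field_simp
  ring

/-! ### Bounds -/

lemma W_lower (j : ℕ) {y : ℝ} (hy : 0 < y) : 4 * 3 ^ j * Real.exp (-(3 * y)) ≤ W j y := by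
  have h := le_hasSum (hasSum_W j hy) 0 (fun n _ => by have := av_ge n; positivity)
  have e : av 0 = 3 := by unfold av; norm_num
  rw [e] at h
  norm_num at h
  exact h

lemma exp_neg_five_lt : Real.exp (-5) ≤ 68 / 10000 := by
  have h1 : Real.exp 5 = Real.exp 1 ^ 5 := by rw [← Real.exp_nat_mul]; norm_num
  have h2 : (2.718 : ℝ) ^ 5 ≤ Real.exp 1 ^ 5 :=
    pow_le_pow_left₀ (by norm_num) (by have := Real.exp_one_gt_d9; linarith) 5
  rw [Real.exp_neg, h1]
  refine inv_le_of_inv_le₀ (by norm_num) (le_trans (by norm_num) h2)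

lemma exp_neg_six_lt : Real.exp (-6) ≤ 1 / 4 := by
  have h1 : Real.exp (-6) ≤ Real.exp (-5) := Real.exp_le_exp.2 (by norm_num)
  linarith [exp_neg_five_lt]

lemma tail_term (j : ℕ) (hj : j ≤ 5) {y : ℝ} (hy : 3 ≤ y) (n : ℕ) :
    (av (n + 1) + 1) * av (n + 1) ^ j * Real.exp (-(av (n + 1) * y)) ≤
      4 * 3 ^ j * Real.exp (-(3 * y)) * (68 / 10000) * (1 / 4) ^ n := by
  obtain ⟨x, hx⟩ : ∃ x, x = av (n + 1) - 3 := ⟨_, rfl⟩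
  have h0 : (0 : ℝ) ≤ n := Nat.cast_nonneg n
  have hx5 : 5 + 6 * n ≤ x := by
    rw [hx]; unfold av; push_cast; nlinarith
  have hx0 : 0 ≤ x := by linarith
  have ha : av (n + 1) = x + 3 := by rw [hx]; ring
  rw [ha]
  have e1 : (1 + x / 3) ^ 6 ≤ Real.exp (2 * x) := by
    have h1 : 1 + x / 3 ≤ Real.exp (x / 3) := by linarith [Real.add_one_le_exp (x / 3)]
    calc (1 + x / 3) ^ 6 ≤ Real.exp (x / 3) ^ 6 := pow_le_pow_left₀ (by positivity) h1 6
      _ = Real.exp (2 * x) := by rw [← Real.exp_nat_mul]; congr 1; push_cast; ring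
  have e2 : (x + 3 + 1) * (x + 3) ^ j ≤ 4 * 3 ^ j * Real.exp (2 * x) := by
    have h1 : (x + 3) ^ j = 3 ^ j * (1 + x / 3) ^ j := by rw [← mul_pow]; congr 1; ring
    have h2 : (1 + x / 3) ^ j ≤ (1 + x / 3) ^ 5 :=
      pow_le_pow_right₀ (by linarith [div_nonneg hx0 (by norm_num : (0 : ℝ) ≤ 3)]) hj
    have h3 : x + 3 + 1 ≤ 4 * (1 + x / 3) := by linarith
    calc (x + 3 + 1) * (x + 3) ^ j ≤ (4 * (1 + x / 3)) * (3 ^ j * (1 + x / 3) ^ 5) := by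
          rw [h1]; gcongr
      _ = 4 * 3 ^ j * (1 + x / 3) ^ 6 := by ring
      _ ≤ _ := by gcongr
  have e3 : Real.exp (-x) ≤ (68 / 10000) * (1 / 4) ^ n := by
    calc Real.exp (-x) ≤ Real.exp (-5 + n * (-6)) := Real.exp_le_exp.2 (by linarith)
      _ = Real.exp (-5) * Real.exp (-6) ^ n := by rw [Real.exp_add, ← Real.exp_nat_mul]
      _ ≤ _ := by
        gcongr
        · exact exp_neg_five_lt
        · exact exp_neg_six_lt
  calc _ ≤ 4 * 3 ^ j * Real.exp (2 * x) * Real.exp (-((x + 3) * y)) := by gcongr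
    _ = 4 * 3 ^ j * Real.exp (-(3 * y)) * Real.exp (2 * x - x * y) := by
      rw [mul_assoc, mul_assoc (4 * 3 ^ j), ← Real.exp_add, ← Real.exp_add]; congr 2; ring
    _ ≤ 4 * 3 ^ j * Real.exp (-(3 * y)) * Real.exp (-x) := by
      gcongr; nlinarith
    _ ≤ 4 * 3 ^ j * Real.exp (-(3 * y)) * ((68 / 10000) * (1 / 4) ^ n) := by gcongr
    _ = _ := by ring

lemma W_upper (j : ℕ) (hj : j ≤ 5) {y : ℝ} (hy : 3 ≤ y) :
    W j y ≤ 4 * 3 ^ j * (101 / 100) * Real.exp (-(3 * y)) := by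
  have hy0 : 0 < y := by linarith
  have hs := (hasSum_W j hy0)
  have hg : HasSum (fun n : ℕ => 4 * 3 ^ j * Real.exp (-(3 * y)) * (68 / 10000) * (1 / 4 : ℝ) ^ n)
      (4 * 3 ^ j * Real.exp (-(3 * y)) * (68 / 10000) * (1 - 1 / 4 : ℝ)⁻¹) :=
    (hasSum_geometric_of_lt_one (by norm_num) (by norm_num)).mul_left _
  have hs2 := (summable_nat_add_iff 1).2 hs.summable
  have h1 := hasSum_le (tail_term j hj hy) hs2.hasSum hg
  rw [← hs.tsum_eq, hs.summable.tsum_eq_zero_add]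
  have e : av 0 = 3 := by unfold av; norm_num
  rw [e]
  have hq : 0 < 4 * 3 ^ j * Real.exp (-(3 * y)) := by positivity
  have h2 : 4 * 3 ^ j * Real.exp (-(3 * y)) * (68 / 10000) * (1 - 1 / 4 : ℝ)⁻¹
      ≤ 4 * 3 ^ j * Real.exp (-(3 * y)) * (1 / 100) := by
    rw [mul_assoc _ (68 / 10000 : ℝ)]
    gcongr
    norm_num
  linarith

lemma exp_lower {d : ℝ} (hd : 0 ≤ d) :
    12000 * (1 + 3 * d + 9 / 2 * d ^ 2 + 9 / 2 * d ^ 3) ≤ Real.exp (3 * (314 / 100 + d)) := by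
  have h1 : 3 * (314 / 100 + d) = (9 : ℕ) * 1 + (42 / 100 + 3 * d) := by push_cast; ring
  have h2 : (2.718 : ℝ) ^ 9 ≤ Real.exp 1 ^ 9 :=
    pow_le_pow_left₀ (by norm_num) (by have := Real.exp_one_gt_d9; linarith) 9
  have h3 : 1 + 3 * d + 9 / 2 * d ^ 2 + 9 / 2 * d ^ 3 ≤ Real.exp (3 * d) := by
    have := Real.sum_le_exp_of_nonneg (x := 3 * d) (by positivity) 4
    simp [Finset.sum_range_succ, Nat.factorial] at this
    nlinarith
  have h4 : 15 / 10 ≤ Real.exp (42 / 100) := by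
    have := Real.sum_le_exp_of_nonneg (x := (42 / 100 : ℝ)) (by positivity) 4
    simp [Finset.sum_range_succ, Nat.factorial] at this
    norm_num at this
    linarith
  rw [h1, Real.exp_add, Real.exp_nat_mul, Real.exp_add]
  have h5 : (12000 : ℝ) ≤ Real.exp 1 ^ 9 * Real.exp (42 / 100) := by
    calc (12000 : ℝ) ≤ 2.718 ^ 9 * (15 / 10) := by norm_num
      _ ≤ _ := by gcongr
  rw [← mul_assoc]
  gcongr

/-- The key polynomial inequality. -/
lemma key_poly {d : ℝ} (hd : 0 ≤ d) {y w : ℝ} (hy : y = 314 / 100 + d) (hw : w = 1 / (2 * y - 3)) :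
    (101 / 100 * 324 * y ^ 4 - 6 * 108 * y ^ 3 + 101 / 100 * 7 * 36 * y ^ 2 - 12 * y)
    + ((3 * w + 135 * w ^ 2 + 1350 * w ^ 3 + 4860 * w ^ 4 + 5832 * w ^ 5) * (12 * (101 / 100))
      + 4 * (3 * w + 63 * w ^ 2 + 324 * w ^ 3 + 486 * w ^ 4) * (y * 36 * (101 / 100))
      + 6 * (3 * w + 27 * w ^ 2 + 54 * w ^ 3) * (101 / 100 * 108 * y ^ 2 - 36 * y)
      + 4 * (3 * w + 9 * w ^ 2) * (101 / 100 * 324 * y ^ 3 - 3 * 108 * y ^ 2 + 101 / 100 * 36 * y)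
      + (1 + 3 * w) * (101 / 100 * 972 * y ^ 4 - 6 * 324 * y ^ 3 + 101 / 100 * 7 * 108 * y ^ 2
          - 36 * y))
    < 12000 * (1 + 3 * d + 9 / 2 * d ^ 2 + 9 / 2 * d ^ 3) *
      (y + (3 * w + 63 * w ^ 2 + 324 * w ^ 3 + 486 * w ^ 4)) := by
  have hv : 0 < 2 * y - 3 := by rw [hy]; linarith
  rw [← sub_pos]
  have h5 : 0 < (2 * y - 3) ^ 5 := by positivity
  refine pos_of_mul_pos_left (b := (2 * y - 3) ^ 5) ?_ h5.le
  have hwv : w * (2 * y - 3) = 1 := by rw [hw]; field_simp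
  obtain ⟨v, hv'⟩ : ∃ v, v = 2 * y - 3 := ⟨_, rfl⟩
  rw [← hv'] at hwv ⊢
  have a1 : w * v ^ 5 = v ^ 4 := by linear_combination v ^ 4 * hwv
  have a2 : w ^ 2 * v ^ 5 = v ^ 3 := by linear_combination w * a1 + v ^ 3 * hwv
  have a3 : w ^ 3 * v ^ 5 = v ^ 2 := by linear_combination w * a2 + v ^ 2 * hwv
  have a4 : w ^ 4 * v ^ 5 = v := by linear_combination w * a3 + v * hwv
  have a5 : w ^ 5 * v ^ 5 = 1 := by linear_combination w * a4 + hwv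
  have e : ∀ A B0 B1 B2 B3 C : ℝ, ∀ D : ℝ,
      (D * (y + (3 * w + 63 * w ^ 2 + 324 * w ^ 3 + 486 * w ^ 4)) -
      (A + ((3 * w + 135 * w ^ 2 + 1350 * w ^ 3 + 4860 * w ^ 4 + 5832 * w ^ 5) * C
      + 4 * (3 * w + 63 * w ^ 2 + 324 * w ^ 3 + 486 * w ^ 4) * B3
      + 6 * (3 * w + 27 * w ^ 2 + 54 * w ^ 3) * B2
      + 4 * (3 * w + 9 * w ^ 2) * B1
      + (1 + 3 * w) * B0))) * v ^ 5 =
      (D * (y * v ^ 5 + (3 * v ^ 4 + 63 * v ^ 3 + 324 * v ^ 2 + 486 * v)) -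
      (A * v ^ 5 + ((3 * v ^ 4 + 135 * v ^ 3 + 1350 * v ^ 2 + 4860 * v + 5832) * C
      + 4 * (3 * v ^ 4 + 63 * v ^ 3 + 324 * v ^ 2 + 486 * v) * B3
      + 6 * (3 * v ^ 4 + 27 * v ^ 3 + 54 * v ^ 2) * B2
      + 4 * (3 * v ^ 4 + 9 * v ^ 3) * B1
      + (v ^ 5 + 3 * v ^ 4) * B0))) := by
    intro A B0 B1 B2 B3 C D
    linear_combination (3 * D - 3 * C - 12 * B3 - 18 * B2 - 12 * B1 - 3 * B0) * a1
      + (63 * D - 135 * C - 252 * B3 - 162 * B2 - 36 * B1) * a2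
      + (324 * D - 1350 * C - 1296 * B3 - 324 * B2) * a3
      + (486 * D - 4860 * C - 1944 * B3) * a4 - 5832 * C * a5
  rw [e, hv', hy]
  ring_nf
  positivity

lemma V_lower (j : ℕ) (s : ℝ) : 4 * 3 ^ j * Real.exp (-(3 * Y s)) ≤ V j s := W_lower j (Y_pos s)
lemma V_upper (j : ℕ) (hj : j ≤ 5) {s : ℝ} (hy : 3 ≤ Y s) :
    V j s ≤ 4 * 3 ^ j * (101 / 100) * Real.exp (-(3 * Y s)) := W_upper j hj hy
lemma V_succ (j : ℕ) (s : ℝ) : 3 * V j s ≤ V (j + 1) s := W_succ_ge j (Y_pos s)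

lemma Y_ge {s : ℝ} (hs : 0 ≤ s) : 314 / 100 ≤ Y s := by
  have h1 := Real.one_le_exp hs
  have h2 := Real.pi_gt_d2
  unfold Y
  nlinarith

lemma V2_nonneg (j : ℕ) {s : ℝ} (hy : 3 ≤ Y s) : 0 ≤ V2 j s := by
  have h1 := V_succ (j + 1) s
  have h2 := V_nonneg (j + 1) s
  have : V2 j s = Y s * (Y s * V (j + 2) s - V (j + 1) s) := by unfold V2; ring
  rw [this]
  refine mul_nonneg (by linarith) ?_
  nlinarith [V_nonneg (j + 2) s]

lemma V3_nonpos (j : ℕ) {s : ℝ} (hy : 3 ≤ Y s) : V3 j s ≤ 0 := by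
  have h1 := V_succ (j + 2) s
  have h2 := V_nonneg (j + 1) s
  have h3 := V_nonneg (j + 2) s
  have h4 := V_nonneg (j + 3) s
  have : V3 j s = -(Y s * (Y s * (Y s * V (j + 3) s - 3 * V (j + 2) s) + V (j + 1) s)) := by
    unfold V3; ring
  rw [this]
  have h5 : 0 ≤ Y s * V (j + 3) s - 3 * V (j + 2) s := by
    rw [show j + 2 + 1 = j + 3 from rfl] at h1
    nlinarith
  have : 0 ≤ Y s := by linarith
  have : 0 ≤ Y s * (Y s * (Y s * V (j + 3) s - 3 * V (j + 2) s) + V (j + 1) s) := by positivity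
  linarith

lemma V1_nonpos (j : ℕ) (s : ℝ) : V1 j s ≤ 0 := by
  have := mul_nonneg (Y_pos s).le (V_nonneg (j + 1) s)
  unfold V1; linarith

lemma r4_bound {s : ℝ} (hs : 0 ≤ s) : r4 s < Y s - c3 s := by
  have hY := Y_ge hs
  have hY3 : 3 ≤ Y s := by linarith
  have hD := Dom.of_nonneg hs
  have hw := hD.w_pos
  have hk := key_poly (d := Y s - 314 / 100) (by linarith) (y := Y s) (by ring) (w := w s) rfl
  have he := exp_lower (d := Y s - 314 / 100) (by linarith)
  rw [show 314 / 100 + (Y s - 314 / 100) = Y s by ring] at he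
  have hc : 0 < Y s + (3 * w s + 63 * w s ^ 2 + 324 * w s ^ 3 + 486 * w s ^ 4) := by
    have := Y_pos s
    positivity
  have hk2 := hk.trans_le (mul_le_mul_of_nonneg_right he hc.le)
  obtain ⟨q, hq⟩ : ∃ q, q = Real.exp (-(3 * Y s)) := ⟨_, rfl⟩
  have hq0 : 0 < q := by rw [hq]; exact Real.exp_pos _
  have hqe : q * Real.exp (3 * Y s) = 1 := by rw [hq, ← Real.exp_add]; simp
  have hk3 := mul_lt_mul_of_pos_left hk2 hq0
  rw [← mul_assoc q (Real.exp (3 * Y s)), hqe, one_mul] at hk3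
  have hY0 := Y_pos s
  have lo : ∀ j, 4 * 3 ^ j * q ≤ V j s := fun j => by rw [hq]; exact V_lower j s
  have up : ∀ j, j ≤ 5 → V j s ≤ 4 * 3 ^ j * (101 / 100) * q := fun j hj => by
    rw [hq]; exact V_upper j hj hY3
  have l1 := lo 1; have l2 := lo 2; have l3 := lo 3; have l4 := lo 4
  have u1 := up 1 (by norm_num); have u2 := up 2 (by norm_num); have u3 := up 3 (by norm_num)
  have u4 := up 4 (by norm_num); have u5 := up 5 (by norm_num)
  norm_num at l1 l2 l3 l4 u1 u2 u3 u4 u5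
  have b40 : V4 0 s ≤ q * (101 / 100 * 324 * Y s ^ 4 - 6 * 108 * Y s ^ 3
      + 101 / 100 * 7 * 36 * Y s ^ 2 - 12 * Y s) := by
    unfold V4
    simp only [zero_add]
    have i1 := mul_le_mul_of_nonneg_left u4 (pow_pos hY0 4).le
    have i2 := mul_le_mul_of_nonneg_left l3 (pow_pos hY0 3).le
    have i3 := mul_le_mul_of_nonneg_left u2 (pow_pos hY0 2).le
    have i4 := mul_le_mul_of_nonneg_left l1 hY0.le
    linarith
  have b41 : V4 1 s ≤ q * (101 / 100 * 972 * Y s ^ 4 - 6 * 324 * Y s ^ 3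
      + 101 / 100 * 7 * 108 * Y s ^ 2 - 36 * Y s) := by
    unfold V4
    norm_num only
    have i1 := mul_le_mul_of_nonneg_left u5 (pow_pos hY0 4).le
    have i2 := mul_le_mul_of_nonneg_left l4 (pow_pos hY0 3).le
    have i3 := mul_le_mul_of_nonneg_left u3 (pow_pos hY0 2).le
    have i4 := mul_le_mul_of_nonneg_left l2 hY0.le
    linarith
  have b31 : -V3 1 s ≤ q * (101 / 100 * 324 * Y s ^ 3 - 3 * 108 * Y s ^ 2
      + 101 / 100 * 36 * Y s) := by
    unfold V3
    norm_num only
    have i2 := mul_le_mul_of_nonneg_left u4 (pow_pos hY0 3).le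
    have i3 := mul_le_mul_of_nonneg_left l3 (pow_pos hY0 2).le
    have i4 := mul_le_mul_of_nonneg_left u2 hY0.le
    linarith
  have b21 : V2 1 s ≤ q * (101 / 100 * 108 * Y s ^ 2 - 36 * Y s) := by
    unfold V2
    norm_num only
    have i3 := mul_le_mul_of_nonneg_left u3 (pow_pos hY0 2).le
    have i4 := mul_le_mul_of_nonneg_left l2 hY0.le
    linarith
  have b11 : -V1 1 s ≤ q * (Y s * 36 * (101 / 100)) := by
    unfold V1
    norm_num only
    have i4 := mul_le_mul_of_nonneg_left u2 hY0.le
    linarith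
  have b01 : V 1 s ≤ q * (12 * (101 / 100)) := by linarith
  have w2 := pow_pos hw 2
  have w3 := pow_pos hw 3
  have w4 := pow_pos hw 4
  have w5 := pow_pos hw 5
  have j0 := mul_le_mul_of_nonneg_left b41 (show 0 ≤ 1 + 3 * w s by linarith)
  have j1 := mul_le_mul_of_nonneg_left b31 (show 0 ≤ 4 * (3 * w s + 9 * w s ^ 2) by linarith)
  have j2 := mul_le_mul_of_nonneg_left b21
    (show 0 ≤ 6 * (3 * w s + 27 * w s ^ 2 + 54 * w s ^ 3) by linarith)
  have j3 := mul_le_mul_of_nonneg_left b11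
    (show 0 ≤ 4 * (3 * w s + 63 * w s ^ 2 + 324 * w s ^ 3 + 486 * w s ^ 4) by linarith)
  have j4 := mul_le_mul_of_nonneg_left b01
    (show 0 ≤ 3 * w s + 135 * w s ^ 2 + 1350 * w s ^ 3 + 4860 * w s ^ 4 + 5832 * w s ^ 5 by
      linarith)
  refine lt_of_le_of_lt ?_ (hk3.trans_le (le_of_eq ?_))
  · unfold r4 c0 c1 c2 c3 c4
    linear_combination b40 + j0 + j1 + j2 + j3 + j4
  · unfold c3; ring

lemma w_le {s : ℝ} (hs : 0 ≤ s) : w s ≤ 1 / 3 := by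
  have := Y_ge hs
  unfold w
  exact one_div_le_one_div_of_le (by norm_num) (by linarith)

lemma r1_nonpos {s : ℝ} (hs : 0 ≤ s) : r1 s ≤ 0 := by
  have hw := (Dom.of_nonneg hs).w_pos
  have h1 := V1_nonpos 0 s
  have h2 := V1_nonpos 1 s
  have h3 := V_nonneg 1 s
  have e1 : 0 ≤ (3 * w s + 9 * w s ^ 2) * V 1 s := by positivity
  have e2 : (1 + 3 * w s) * V1 1 s ≤ 0 := mul_nonpos_of_nonneg_of_nonpos (by positivity) h2
  unfold r1 c0 c1
  linarith

lemma r3_nonpos {s : ℝ} (hs : 0 ≤ s) : r3 s ≤ 0 := by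
  have hY3 : 3 ≤ Y s := by linarith [Y_ge hs]
  have hw := (Dom.of_nonneg hs).w_pos
  have e0 := V3_nonpos 0 hY3
  have e1 : 0 ≤ (3 * w s + 63 * w s ^ 2 + 324 * w s ^ 3 + 486 * w s ^ 4) * V 1 s :=
    mul_nonneg (by positivity) (V_nonneg 1 s)
  have e2 : 3 * (3 * w s + 27 * w s ^ 2 + 54 * w s ^ 3) * V1 1 s ≤ 0 :=
    mul_nonpos_of_nonneg_of_nonpos (by positivity) (V1_nonpos 1 s)
  have e3 : 0 ≤ 3 * (3 * w s + 9 * w s ^ 2) * V2 1 s :=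
    mul_nonneg (by positivity) (V2_nonneg 1 hY3)
  have e4 : (1 + 3 * w s) * V3 1 s ≤ 0 :=
    mul_nonpos_of_nonneg_of_nonpos (by positivity) (V3_nonpos 1 hY3)
  unfold r3 c0 c1 c2 c3
  linarith

lemma V2_small {s : ℝ} (hs : 0 ≤ s) : V 2 s ≤ 1 / 100 := by
  have hY := Y_ge hs
  have h1 := V_upper 2 (by norm_num) (show 3 ≤ Y s by linarith)
  have he := exp_lower (d := Y s - 314 / 100) (by linarith)
  rw [show 314 / 100 + (Y s - 314 / 100) = Y s by ring] at he
  have hd : 0 ≤ Y s - 314 / 100 := by linarith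
  have h2 : (12000 : ℝ) ≤ Real.exp (3 * Y s) := by
    have : 0 ≤ 3 * (Y s - 314 / 100) + 9 / 2 * (Y s - 314 / 100) ^ 2
      + 9 / 2 * (Y s - 314 / 100) ^ 3 := by positivity
    linarith
  have h3 : Real.exp (-(3 * Y s)) ≤ 1 / 12000 := by
    rw [Real.exp_neg, ← one_div]
    exact one_div_le_one_div_of_le (by norm_num) h2
  norm_num at h1
  linarith

lemma r1_sq_le {s : ℝ} (hs : 0 ≤ s) : 4 * r1 s ^ 2 ≤ r2 s := by
  have hY := Y_ge hs
  have hY3 : 3 ≤ Y s := by linarith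
  have hw := (Dom.of_nonneg hs).w_pos
  have hw3 := w_le hs
  have hsm := V2_small hs
  have v1 := V_nonneg 1 s
  have v2 := V_nonneg 2 s
  have v12 := V_succ 1 s
  norm_num at v12
  have hlow : 8 / 9 * Y s ^ 2 * V 2 s ≤ r2 s := by
    have e1 : 0 ≤ (3 * w s + 27 * w s ^ 2 + 54 * w s ^ 3) * V 1 s :=
      mul_nonneg (by positivity) v1
    have e2 : 2 * (3 * w s + 9 * w s ^ 2) * V1 1 s ≤ 0 :=
      mul_nonpos_of_nonneg_of_nonpos (by positivity) (V1_nonpos 1 s)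
    have e3 : 0 ≤ (1 + 3 * w s) * V2 1 s := mul_nonneg (by positivity) (V2_nonneg 1 hY3)
    have e4 : 8 / 9 * Y s ^ 2 * V 2 s ≤ V2 0 s := by
      unfold V2
      simp only [zero_add]
      have i1 : Y s * V 1 s ≤ Y s * (V 2 s / 3) :=
        mul_le_mul_of_nonneg_left (by linarith) (by linarith)
      have i2 : 3 * (Y s * V 2 s) ≤ Y s * (Y s * V 2 s) :=
        mul_le_mul_of_nonneg_right hY3 (mul_nonneg (by linarith) v2)
      linarith
    unfold r2 c0 c1 c2
    linarith
  have hup : -r1 s ≤ 3 * Y s * V 2 s := by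
    have e1 : (3 * w s + 9 * w s ^ 2) * V 1 s ≤ 2 * V 1 s :=
      mul_le_mul_of_nonneg_right (by nlinarith) v1
    have e2 : (1 + 3 * w s) * (Y s * V 2 s) ≤ 2 * (Y s * V 2 s) :=
      mul_le_mul_of_nonneg_right (by linarith) (mul_nonneg (by linarith) v2)
    have i1 : Y s * V 1 s ≤ Y s * (V 2 s / 3) :=
        mul_le_mul_of_nonneg_left (by linarith) (by linarith)
    have i2 : 3 * V 2 s ≤ Y s * V 2 s := mul_le_mul_of_nonneg_right hY3 v2
    unfold r1 c0 c1 V1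
    norm_num only
    linarith
  have h1 := r1_nonpos hs
  have h2 : r1 s ^ 2 ≤ (3 * Y s * V 2 s) ^ 2 := by
    rw [← neg_sq (r1 s)]
    exact pow_le_pow_left₀ (by linarith) hup 2
  have h3 : (3 * Y s * V 2 s) ^ 2 ≤ 9 * Y s ^ 2 * V 2 s * (1 / 100) := by
    have : (3 * Y s * V 2 s) ^ 2 = 9 * Y s ^ 2 * V 2 s * V 2 s := by ring
    rw [this]
    exact mul_le_mul_of_nonneg_left hsm (by positivity)
  have h4 : 0 ≤ Y s ^ 2 * V 2 s := by positivity
  linarith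

lemma N4_neg {s : ℝ} (hs : 0 ≤ s) : N4 s < 0 := by
  have hr := (Dom.of_nonneg hs).r0_nonneg
  have hu0 : 0 < u s := by unfold u; positivity
  have hu1 : u s ≤ 1 := by
    unfold u; rw [div_le_one (by linarith)]; linarith
  have h4 := r4_bound hs
  have hY := Y_pos s
  have hw := (Dom.of_nonneg hs).w_pos
  have hc : c3 s < 0 := by
    have : 0 < 3 * w s + 63 * w s ^ 2 + 324 * w s ^ 3 + 486 * w s ^ 4 := by positivity
    unfold c3; linarith
  have a1 : r4 s * u s < Y s - c3 s := by
    rcases le_or_gt (r4 s) 0 with h | h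
    · have := mul_nonpos_of_nonpos_of_nonneg h hu0.le
      linarith
    · have := mul_le_mul_of_nonneg_left hu1 h.le
      linarith
  have a2 : 0 ≤ 4 * (r1 s * r3 s) * u s ^ 2 := by
    have := mul_nonneg_of_nonpos_of_nonpos (r1_nonpos hs) (r3_nonpos hs)
    positivity
  have hq := r1_sq_le hs
  have h2 : 0 ≤ r2 s := by nlinarith [sq_nonneg (r1 s)]
  have a3 : 12 * r1 s ^ 2 * r2 s * u s ^ 3 ≤ 3 * r2 s ^ 2 * u s ^ 2 := by
    calc 12 * r1 s ^ 2 * r2 s * u s ^ 3 = 3 * (4 * r1 s ^ 2) * r2 s * u s ^ 2 * u s := by ring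
      _ ≤ 3 * r2 s * r2 s * u s ^ 2 * 1 := by gcongr
      _ = _ := by ring
  have a4 : 0 ≤ 6 * r1 s ^ 4 * u s ^ 4 := by positivity
  unfold N4
  linarith

/-! ### Conclusion -/

noncomputable def M (s : ℝ) : ℝ := Real.log (jacobiPhi (s / 4))

lemma M_even (s : ℝ) : M (-s) = M s := by
  unfold M; rw [neg_div, jacobiPhi_even]

lemma M_eq {s : ℝ} (h : Dom s) : M s = N0 s := by
  have e : 4 * (s / 4) = s := by ring
  unfold M
  rw [jacobiPhi_eq (by rwa [e]), Real.log_exp, e]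

lemma dM {s : ℝ} (h : Dom s) : deriv M s = N1 s := by
  have : M =ᶠ[nhds s] N0 := h.open_nhds.mono fun x hx => M_eq hx
  rw [this.deriv_eq, (dN0 h).deriv]

lemma dM2 {s : ℝ} (h : Dom s) : deriv (deriv M) s = N2 s := by
  have : deriv M =ᶠ[nhds s] N1 := h.open_nhds.mono fun x hx => dM hx
  rw [this.deriv_eq, (dN1 h).deriv]

lemma dM3 {s : ℝ} (h : Dom s) : deriv (deriv (deriv M)) s = N3 s := by
  have : deriv (deriv M) =ᶠ[nhds s] N2 := h.open_nhds.mono fun x hx => dM2 hx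
  rw [this.deriv_eq, (dN2 h).deriv]

lemma N1_zero : N1 0 = 0 := by
  rw [← dM (Dom.of_nonneg le_rfl)]
  have := deriv_odd M_even 0
  rw [neg_zero] at this
  linarith

lemma N3_zero : N3 0 = 0 := by
  rw [← dM3 (Dom.of_nonneg le_rfl)]
  have := deriv_odd (deriv_even (deriv_odd M_even)) 0
  rw [neg_zero] at this
  linarith

lemma N3_neg {s : ℝ} (hs : 0 < s) : N3 s < 0 := by
  have h : StrictAntiOn N3 (Set.Ici 0) := by
    refine strictAntiOn_of_deriv_neg (convex_Ici 0)
      (fun x hx => (dN3 (Dom.of_nonneg hx)).continuousAt.continuousWithinAt) (fun x hx => ?_)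
    rw [interior_Ici] at hx
    have hx0 : 0 ≤ x := le_of_lt hx
    rw [(dN3 (Dom.of_nonneg hx0)).deriv]
    exact N4_neg hx0
  have := h (Set.mem_Ici.2 le_rfl) (Set.mem_Ici.2 hs.le) hs
  rwa [N3_zero] at this

lemma N2_anti : StrictAntiOn N2 (Set.Ici 0) := by
  refine strictAntiOn_of_deriv_neg (convex_Ici 0)
    (fun x hx => (dN2 (Dom.of_nonneg hx)).continuousAt.continuousWithinAt) (fun x hx => ?_)
  rw [interior_Ici] at hx
  have hx0 : 0 ≤ x := le_of_lt hx
  rw [(dN2 (Dom.of_nonneg hx0)).deriv]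
  exact N3_neg hx

lemma main {s : ℝ} (hs : 0 < s) : s * N2 s < N1 s := by
  obtain ⟨x, hx, he⟩ := exists_hasDerivAt_eq_slope N1 N2 hs
    (fun x hx => (dN1 (Dom.of_nonneg hx.1)).continuousAt.continuousWithinAt)
    (fun x hx => dN1 (Dom.of_nonneg hx.1.le))
  rw [N1_zero, sub_zero, sub_zero, eq_div_iff hs.ne'] at he
  have := N2_anti (Set.mem_Ici.2 hx.1.le) (Set.mem_Ici.2 hs.le) hx.2
  nlinarith

lemma dom_t {t : ℝ} (ht : 0 < t) : Dom (4 * t) := Dom.of_nonneg (by linarith)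

lemma d4 (t : ℝ) : HasDerivAt (fun t : ℝ => 4 * t) (4 * 1) t := (hasDerivAt_id t).const_mul 4

lemma dPhi {t : ℝ} (ht : 0 < t) :
    HasDerivAt jacobiPhi (jacobiPhi t * (4 * N1 (4 * t))) t := by
  have h1 : HasDerivAt (fun t => Real.exp (N0 (4 * t)))
      (Real.exp (N0 (4 * t)) * (N1 (4 * t) * (4 * 1))) t :=
    ((dN0 (dom_t ht)).comp t (d4 t)).exp
  have h2 : jacobiPhi =ᶠ[nhds t] fun t => Real.exp (N0 (4 * t)) :=
    (eventually_gt_nhds ht).mono fun x hx => jacobiPhi_eq (dom_t hx)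
  refine (h1.congr_of_eventuallyEq h2).congr_deriv ?_
  rw [jacobiPhi_eq (dom_t ht)]
  ring

lemma dPhi2 {t : ℝ} (ht : 0 < t) : iteratedDeriv 2 jacobiPhi t =
    jacobiPhi t * (4 * N1 (4 * t)) ^ 2 + jacobiPhi t * (16 * N2 (4 * t)) := by
  rw [iteratedDeriv_succ, iteratedDeriv_one]
  have h2 : deriv jacobiPhi =ᶠ[nhds t] fun t => jacobiPhi t * (4 * N1 (4 * t)) :=
    (eventually_gt_nhds ht).mono fun x hx => (dPhi hx).deriv
  have h3 : HasDerivAt (fun t => N1 (4 * t)) (N2 (4 * t) * (4 * 1)) t :=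
    (dN1 (dom_t ht)).comp t (d4 t)
  rw [h2.deriv_eq, ((dPhi ht).fun_mul (h3.const_mul 4)).deriv]
  ring

lemma dsq (k : ℝ → ℝ) (k' : ℝ) {t : ℝ} (ht : 0 < t) (hk : HasDerivAt k k' (4 * √t)) :
    HasDerivAt (fun x => k (4 * √x)) (k' * (2 / √t)) t := by
  have h1 : HasDerivAt (fun x => 4 * √x) (4 * (1 / (2 * √t))) t :=
    (Real.hasDerivAt_sqrt ht.ne').const_mul 4
  refine (HasDerivAt.comp t hk h1).congr_deriv ?_
  have := (Real.sqrt_pos.2 ht).ne'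
  field_simp
  ring

lemma dlog1 {t : ℝ} (ht : 0 < t) :
    deriv (fun x => Real.log (jacobiPhi √x)) t = N1 (4 * √t) * (2 / √t) := by
  have h2 : (fun x => Real.log (jacobiPhi √x)) =ᶠ[nhds t] fun x => N0 (4 * √x) :=
    (eventually_gt_nhds ht).mono fun x hx => by
      change Real.log (jacobiPhi √x) = N0 (4 * √x)
      rw [jacobiPhi_eq (dom_t (Real.sqrt_pos.2 hx)), Real.log_exp]
  rw [h2.deriv_eq, (dsq _ _ ht (dN0 (dom_t (Real.sqrt_pos.2 ht)))).deriv]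

lemma dlog2 {t : ℝ} (ht : 0 < t) :
    iteratedDeriv 2 (fun x => Real.log (jacobiPhi √x)) t
      = (4 * √t * N2 (4 * √t) - N1 (4 * √t)) / √t ^ 3 := by
  rw [iteratedDeriv_succ, iteratedDeriv_one]
  have h2 : deriv (fun x => Real.log (jacobiPhi √x)) =ᶠ[nhds t]
      fun x => N1 (4 * √x) * (2 / √x) :=
    (eventually_gt_nhds ht).mono fun x hx => dlog1 hx
  have hp := (Real.sqrt_pos.2 ht).ne'
  have h3 := dsq _ _ ht (dN1 (dom_t (Real.sqrt_pos.2 ht)))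
  have h4 : HasDerivAt (fun x => 2 / √x) (2 * (-(1 / (2 * √t)) / √t ^ 2)) t := by
    simp only [div_eq_mul_inv (2 : ℝ) √_]
    exact ((Real.hasDerivAt_sqrt ht.ne').fun_inv hp).const_mul 2
  rw [h2.deriv_eq, (h3.fun_mul h4).deriv]
  field_simp
  ring

end JP

/-- **Theorem 4.2 (b).** The function `t ↦ log Φ(√t)` is strictly concave for `t > 0`,
i.e. `(d²/dt²) log Φ(√t) < 0` for all `t > 0`; equivalently,
`t·(Φ′(t)² − Φ(t)Φ″(t)) + Φ(t)Φ′(t) > 0` for all `t > 0`. -/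
theorem thm_4_2_b :
    ∀ t : ℝ, 0 < t →
      iteratedDeriv 2 (fun u => Real.log (jacobiPhi (Real.sqrt u))) t < 0 ∧
      0 < t * ((deriv jacobiPhi t) ^ 2 - jacobiPhi t * iteratedDeriv 2 jacobiPhi t) +
        jacobiPhi t * deriv jacobiPhi t := by
  intro t ht
  constructor
  · rw [JP.dlog2 ht]
    have hp := Real.sqrt_pos.2 ht
    have := JP.main (s := 4 * Real.sqrt t) (by positivity)
    exact div_neg_of_neg_of_pos (by linarith) (by positivity)
  · rw [JP.dPhi2 ht, (JP.dPhi ht).deriv]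
    have h1 := JP.main (s := 4 * t) (by positivity)
    have h2 : 0 < jacobiPhi t := by
      rw [JP.jacobiPhi_eq (JP.dom_t ht)]; exact Real.exp_pos _
    have h3 : 0 < 4 * jacobiPhi t ^ 2 * (JP.N1 (4 * t) - 4 * t * JP.N2 (4 * t)) :=
      mul_pos (by positivity) (by linarith)
    refine h3.trans_eq ?_
    ring
end

section
/- The function t ↦ Φ(√t) is strictly convex for t > 0 (i.e. (d²/dt²) Φ(√t) > 0 for all t > 0), and consequently ∫_{0}^{∞} Φ(√t)·cos(xt) dt > 0 for all x ∈ ℝ. -/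
open Polynomial Filter Topology

noncomputable section

/-- The frequency `π (n+1)²`. -/
def kf (n : ℕ) : ℝ := Real.pi * ((n : ℝ) + 1) ^ 2

/-- The argument `π (n+1)² e^{4s}`. -/
def kz (n : ℕ) (s : ℝ) : ℝ := kf n * Real.exp (4 * s)

/-- General term. -/
def kterm (P : ℝ[X]) (n : ℕ) (s : ℝ) : ℝ :=
  Real.exp s * P.eval (kz n s) * Real.exp (-(kz n s))

/-- General series. -/
def kF (P : ℝ[X]) (s : ℝ) : ℝ := ∑' n : ℕ, kterm P n s

/-- The action of `d/ds` on the polynomial. -/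
def kT (P : ℝ[X]) : ℝ[X] := P + C 4 * X * (derivative P - P)

lemma kf_lower (n : ℕ) : 3 * ((n : ℝ) + 1) ≤ kf n := by
  have := Real.pi_gt_three
  have hn : (0 : ℝ) ≤ n := n.cast_nonneg
  unfold kf
  nlinarith [mul_nonneg (mul_nonneg hn (by linarith : (0:ℝ) ≤ n + 1)) (by linarith : 0 ≤ Real.pi - 3),
    mul_nonneg hn (by linarith : (0:ℝ) ≤ n + 1)]

lemma kf_pos (n : ℕ) : 0 < kf n := by unfold kf; positivity

lemma kz_pos (n : ℕ) (s : ℝ) : 0 < kz n s := mul_pos (kf_pos n) (Real.exp_pos _)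

lemma kz_deriv (n : ℕ) (s : ℝ) : HasDerivAt (kz n) (4 * kz n s) s := by
  have h : HasDerivAt (fun s : ℝ => 4 * s) 4 s := by
    simpa using (hasDerivAt_id s).const_mul (4 : ℝ)
  have := (h.exp).const_mul (kf n)
  refine this.congr_deriv ?_
  unfold kz; ring

lemma kterm_deriv (P : ℝ[X]) (n : ℕ) (s : ℝ) :
    HasDerivAt (kterm P n) (kterm (kT P) n s) s := by
  have hz := kz_deriv n s
  have h1 := (P.hasDerivAt (kz n s)).comp s hz
  have h2 := ((Real.hasDerivAt_exp s).mul h1).mul (hz.neg.exp)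
  refine h2.congr_deriv ?_
  simp only [kterm, kT, Function.comp, eval_add, eval_mul, eval_sub, eval_C, eval_X, Pi.mul_apply, Pi.neg_apply]
  ring

lemma poly_bound (P : ℝ[X]) : ∃ K : ℝ, 0 ≤ K ∧ ∀ z : ℝ, 0 ≤ z → |P.eval z| ≤ K * Real.exp (z / 2) := by
  induction P using Polynomial.induction_on' with
  | add p q hp hq =>
    obtain ⟨K, hK, h⟩ := hp
    obtain ⟨L, hL, h'⟩ := hq
    refine ⟨K + L, by positivity, fun z hz => ?_⟩
    rw [eval_add, add_mul]
    exact (abs_add_le _ _).trans (add_le_add (h z hz) (h' z hz))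
  | monomial k a =>
    refine ⟨|a| * (2 ^ k * k.factorial), by positivity, fun z hz => ?_⟩
    have h := Real.pow_div_factorial_le_exp (z / 2) (by positivity) k
    rw [div_le_iff₀ (by positivity), div_pow, div_le_iff₀ (by positivity)] at h
    rw [eval_monomial, abs_mul, abs_of_nonneg (by positivity : 0 ≤ z ^ k)]
    calc |a| * z ^ k ≤ |a| * (Real.exp (z/2) * k.factorial * 2 ^ k) := by gcongr
      _ = _ := by ring

lemma kterm_bound (P : ℝ[X]) : ∃ K : ℝ, 0 ≤ K ∧ ∀ n s,
    |kterm P n s| ≤ K * (Real.exp s * Real.exp (-(kz n s) / 2)) := by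
  obtain ⟨K, hK, h⟩ := poly_bound P
  refine ⟨K, hK, fun n s => ?_⟩
  unfold kterm
  rw [abs_mul, abs_mul, Real.abs_exp, Real.abs_exp]
  calc Real.exp s * |P.eval (kz n s)| * Real.exp (-(kz n s))
      ≤ Real.exp s * (K * Real.exp (kz n s / 2)) * Real.exp (-(kz n s)) := by
        gcongr; exact h _ (kz_pos n s).le
    _ = K * (Real.exp s * (Real.exp (kz n s / 2) * Real.exp (-(kz n s)))) := by ring
    _ = _ := by rw [← Real.exp_add]; ring_nf

lemma kterm_bound_loc (P : ℝ[X]) (R : ℝ) : ∃ u : ℕ → ℝ, Summable u ∧ ∀ n s, s ∈ Set.Ioo (-R) R →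
    ‖kterm P n s‖ ≤ u n := by
  obtain ⟨K, hK, h⟩ := kterm_bound P
  refine ⟨fun n => K * (Real.exp R * (Real.exp (-(Real.exp (4 * (-R))))) ^ n), ?_, ?_⟩
  · refine ((summable_geometric_of_lt_one (Real.exp_pos _).le ?_).mul_left _).mul_left _
    rw [Real.exp_lt_one_iff]
    exact neg_lt_zero.mpr (Real.exp_pos _)
  · intro n s hs
    refine (h n s).trans ?_
    beta_reduce
    rw [← Real.exp_nat_mul]
    have h1 : Real.exp (4 * (-R)) ≤ Real.exp (4 * s) := Real.exp_le_exp.mpr (by linarith [hs.1])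
    have h2 := kf_lower n
    have h3 : (0 : ℝ) ≤ n := n.cast_nonneg
    have h4 : 3 * ((n : ℝ) + 1) * Real.exp (4 * (-R)) ≤ kz n s :=
      mul_le_mul h2 h1 (Real.exp_pos _).le (kf_pos n).le
    have h5 := Real.exp_pos (4 * (-R))
    have h6 := mul_nonneg h3 h5.le
    gcongr
    · exact hs.2.le
    · linarith

lemma kterm_summable (P : ℝ[X]) (s : ℝ) : Summable fun n => kterm P n s := by
  obtain ⟨u, hu, h⟩ := kterm_bound_loc P (|s| + 1)
  refine Summable.of_norm_bounded hu fun n => h n s ?_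
  constructor
  · linarith [neg_abs_le s]
  · linarith [le_abs_self s]

lemma kF_deriv (P : ℝ[X]) (s : ℝ) : HasDerivAt (kF P) (kF (kT P) s) s := by
  obtain ⟨u, hu, h⟩ := kterm_bound_loc (kT P) (|s| + 1)
  have hs : s ∈ Set.Ioo (-(|s| + 1)) (|s| + 1) :=
    ⟨by linarith [neg_abs_le s], by linarith [le_abs_self s]⟩
  exact hasDerivAt_tsum_of_isPreconnected hu isOpen_Ioo isPreconnected_Ioo
    (fun n y _ => kterm_deriv P n y) h hs (kterm_summable P s) hs

lemma kF_decay (P : ℝ[X]) : ∃ K : ℝ, 0 ≤ K ∧ ∀ s, 0 ≤ s → |kF P s| ≤ K * Real.exp (-(s ^ 2)) := by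
  obtain ⟨K, hK, h⟩ := kterm_bound P
  have hsum : Summable fun n : ℕ => K * Real.exp (-1) ^ n :=
    (summable_geometric_of_lt_one (Real.exp_pos _).le (by
      rw [Real.exp_lt_one_iff]; norm_num)).mul_left _
  refine ⟨∑' n : ℕ, K * Real.exp (-1) ^ n, tsum_nonneg fun n => by positivity, fun s hs => ?_⟩
  rw [← tsum_mul_right]
  have hsum' := hsum.mul_right (Real.exp (-(s ^ 2)))
  have hb : ∀ n, ‖kterm P n s‖ ≤ K * Real.exp (-1) ^ n * Real.exp (-(s ^ 2)) := by
    intro n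
    refine (h n s).trans ?_
    rw [← Real.exp_nat_mul, mul_assoc, ← Real.exp_add, ← Real.exp_add]
    have h1 := Real.quadratic_le_exp_of_nonneg (x := 4 * s) (by positivity)
    have h2 := kf_lower n
    have h3 : (0 : ℝ) ≤ n := n.cast_nonneg
    have h4 : 3 * ((n : ℝ) + 1) * (1 + 4 * s + (4 * s) ^ 2 / 2) ≤ kz n s :=
      mul_le_mul h2 h1 (by positivity) (kf_pos n).le
    have h5 : 0 ≤ (n : ℝ) * (4 * s + (4 * s) ^ 2 / 2) := by positivity
    refine mul_le_mul_of_nonneg_left (Real.exp_le_exp.mpr ?_) hK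
    nlinarith [sq_nonneg s]
  exact tsum_of_norm_bounded hsum'.hasSum hb

/-- The theta function `e^s θ(e^{4s})`. -/
def kG (s : ℝ) : ℝ := Real.exp s + 2 * kF 1 s

lemma kG_eq (s : ℝ) :
    kG s = Real.exp s * ∑' n : ℤ, Real.exp (-Real.pi * Real.exp (4 * s) * (n : ℝ) ^ 2) := by
  have hs : Summable fun n : ℕ => Real.exp (-(kz n s)) := by
    have := (kterm_summable 1 s).mul_left (Real.exp (-s))
    refine this.congr fun n => ?_
    simp only [kterm, eval_one, mul_one]
    rw [← mul_assoc, ← Real.exp_add]; simp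
  have h1 : ∀ n : ℕ, Real.exp (-Real.pi * Real.exp (4 * s) * (((n : ℤ) + 1 : ℤ) : ℝ) ^ 2)
      = Real.exp (-(kz n s)) := by
    intro n; unfold kz kf; congr 1; push_cast; ring
  have h2 : ∀ n : ℕ, Real.exp (-Real.pi * Real.exp (4 * s) * ((-((n : ℤ) + 1) : ℤ) : ℝ) ^ 2)
      = Real.exp (-(kz n s)) := by
    intro n; unfold kz kf; congr 1; push_cast; ring
  have h := HasSum.of_add_one_of_neg_add_one
    (f := fun n : ℤ => Real.exp (-Real.pi * Real.exp (4 * s) * (n : ℝ) ^ 2))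
    (by simp only [h1]; exact hs.hasSum) (by simp only [h2]; exact hs.hasSum)
  rw [h.tsum_eq]
  have h3 : kF 1 s = Real.exp s * ∑' n, Real.exp (-(kz n s)) := by
    rw [← tsum_mul_left]; unfold kF kterm; simp
  unfold kG
  rw [h3]; simp; ring

lemma kG_even (s : ℝ) : kG (-s) = kG s := by
  rw [kG_eq s, kG_eq (-s), Real.tsum_exp_neg_mul_int_sq (Real.exp_pos _), ← Real.exp_mul,
    ← mul_assoc]
  congr 1
  · rw [one_div, ← Real.exp_neg, ← Real.exp_add]; ring_nf
  · congr 1; ext n; congr 2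
    rw [div_eq_mul_inv, ← Real.exp_neg]; ring_nf

lemma even_deriv {f f' : ℝ → ℝ} (h : ∀ s, HasDerivAt f (f' s) s) (hf : ∀ s, f (-s) = f s) (s : ℝ) :
    f' (-s) = - f' s := by
  have h1 := (h (-s)).comp s (hasDerivAt_neg s)
  have h2 : HasDerivAt f (f' (-s) * -1) s := h1.congr_of_eventuallyEq
    (Eventually.of_forall fun t => (hf t).symm)
  linarith [h2.unique (h s)]

lemma odd_deriv {f f' : ℝ → ℝ} (h : ∀ s, HasDerivAt f (f' s) s) (hf : ∀ s, f (-s) = - f s) (s : ℝ) :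
    f' (-s) = f' s := by
  have h1 := ((h (-s)).comp s (hasDerivAt_neg s)).neg
  have h2 : HasDerivAt f (-(f' (-s) * -1)) s := h1.congr_of_eventuallyEq
    (Eventually.of_forall fun t => by simp [hf t])
  linarith [h2.unique (h s)]

/-- The polynomial of `Φ`. -/
def kP : ℝ[X] := C 2 * X ^ 2 - C 3 * X

lemma phi_eq : jacobiPhi = kF kP := by
  ext t
  unfold jacobiPhi kF
  congr 1; ext n
  simp only [kterm, kP, kz, kf, eval_sub, eval_mul, eval_C, eval_pow, eval_X]
  rw [sub_eq_add_neg (5 * t), Real.exp_add, show 5 * t = t + 4 * t by ring, Real.exp_add]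
  ring

lemma kF_add (P Q : ℝ[X]) (s : ℝ) : kF (P + Q) s = kF P s + kF Q s := by
  unfold kF
  rw [← (kterm_summable P s).tsum_add (kterm_summable Q s)]
  congr 1; ext n; simp only [kterm, eval_add]; ring

lemma kF_smul (a : ℝ) (Q : ℝ[X]) (s : ℝ) : kF (C a * Q) s = a * kF Q s := by
  unfold kF
  rw [← tsum_mul_left]
  congr 1; ext n; simp only [kterm, eval_mul, eval_C]; ring

lemma kT2 : kT (kT 1) = 1 + C 8 * kP := by
  apply Polynomial.funext
  intro x
  simp [kT, kP]
  ring

lemma phi_even (s : ℝ) : kF kP (-s) = kF kP s := by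
  have h1 : ∀ s, HasDerivAt kG (Real.exp s + 2 * kF (kT 1) s) s := fun s =>
    (Real.hasDerivAt_exp s).add ((kF_deriv 1 s).const_mul 2)
  have h2 : ∀ s, HasDerivAt (fun s => Real.exp s + 2 * kF (kT 1) s)
      (Real.exp s + 2 * kF (kT (kT 1)) s) s := fun s =>
    (Real.hasDerivAt_exp s).add ((kF_deriv (kT 1) s).const_mul 2)
  have h3 := odd_deriv h2 (even_deriv h1 kG_even) s
  have h4 := kG_even s
  simp only [kT2, kF_add, kF_smul] at h3
  unfold kG at h4
  linarith

lemma phi1_zero : kF (kT kP) 0 = 0 := by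
  have := even_deriv (kF_deriv kP) phi_even 0
  simp at this
  linarith

lemma phi3_zero : kF (kT (kT (kT kP))) 0 = 0 := by
  have := even_deriv (kF_deriv _) (odd_deriv (kF_deriv _) (even_deriv (kF_deriv kP) phi_even)) 0
  simp at this
  linarith

lemma P1_eval (z : ℝ) : (kT kP).eval z = -8 * z ^ 3 + 30 * z ^ 2 - 15 * z := by
  simp [kT, kP]; ring

lemma P2_eval (z : ℝ) : (kT (kT kP)).eval z = 32 * z ^ 4 - 224 * z ^ 3 + 330 * z ^ 2 - 75 * z := by
  simp [kT, kP]; ring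

lemma P4_eval (z : ℝ) : (kT (kT (kT (kT kP)))).eval z =
    z * (512 * z ^ 5 - 8448 * z ^ 4 + 41408 * z ^ 3 - 68096 * z ^ 2 + 30930 * z - 1875) := by
  simp [kT, kP]; ring

lemma P4_big (z : ℝ) (hz : 12 ≤ z) :
    0 < 512 * z ^ 5 - 8448 * z ^ 4 + 41408 * z ^ 3 - 68096 * z ^ 2 + 30930 * z - 1875 := by
  obtain ⟨w, rfl⟩ : ∃ w, z = 12 + w := ⟨z - 12, by ring⟩
  have hw : 0 ≤ w := by linarith
  have : 512 * (12 + w) ^ 5 - 8448 * (12 + w) ^ 4 + 41408 * (12 + w) ^ 3 - 68096 * (12 + w) ^ 2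
      + 30930 * (12 + w) - 1875
      = 14340741 + 10976466 * w + 2970880 * w ^ 2 + 373184 * w ^ 3 + 22272 * w ^ 4 + 512 * w ^ 5 := by
    ring
  rw [this]; positivity

lemma P4_small (z : ℝ) (hz : 3.14 ≤ z) (hz' : z ≤ 4.25) :
    0 < 512 * z ^ 5 - 8448 * z ^ 4 + 41408 * z ^ 3 - 68096 * z ^ 2 + 30930 * z - 1875 := by
  have ha : 0 ≤ z - 3.14 := by linarith
  have hb : 0 ≤ 4.25 - z := by linarith
  have h0 := pow_nonneg ha 5
  have h1 := mul_nonneg (pow_nonneg ha 4) hb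
  have h2 := mul_nonneg (pow_nonneg ha 3) (pow_nonneg hb 2)
  have h3 := mul_nonneg (pow_nonneg ha 2) (pow_nonneg hb 3)
  have h4 := mul_nonneg ha (pow_nonneg hb 4)
  have h5 := pow_nonneg hb 5
  nlinarith only [h0, h1, h2, h3, h4, h5]

lemma kz_ge (n : ℕ) (s : ℝ) (hs : 0 ≤ s) : 12 ≤ kz (n + 1) s := by
  have h1 : 1 ≤ Real.exp (4 * s) := Real.one_le_exp (by positivity)
  have h2 := Real.pi_gt_three
  have h3 : (0 : ℝ) ≤ n := n.cast_nonneg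
  have h4 : 12 ≤ kf (n + 1) := by
    unfold kf; push_cast
    nlinarith [mul_nonneg h3 h3, mul_nonneg h3 (by linarith : 0 ≤ Real.pi - 3),
      mul_nonneg (mul_nonneg h3 h3) (by linarith : 0 ≤ Real.pi - 3)]
  unfold kz
  nlinarith

lemma kz_zero (s : ℝ) : kz 0 s = Real.pi * Real.exp (4 * s) := by simp [kz, kf]

lemma kz_zero_ge (s : ℝ) (hs : 0 ≤ s) : 3.14 ≤ kz 0 s := by
  rw [kz_zero]
  have h1 : 1 ≤ Real.exp (4 * s) := Real.one_le_exp (by positivity)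
  have h2 := Real.pi_gt_d2
  nlinarith

lemma phi_pos (s : ℝ) (hs : 0 ≤ s) : 0 < kF kP s := by
  have h : ∀ n, 0 < kterm kP n s := by
    intro n
    have hz : 3 ≤ kz n s := by
      cases n with
      | zero => have := kz_zero_ge s hs; norm_num at *; linarith
      | succ n => linarith [kz_ge n s hs]
    have : 0 < kP.eval (kz n s) := by simp [kP]; nlinarith
    unfold kterm; positivity
  exact (kterm_summable kP s).tsum_pos (fun n => (h n).le) 0 (h 0)

lemma phi4_pos (s : ℝ) (hs : 0 ≤ s) (hz : kz 0 s ≤ 4.25) : 0 < kF (kT (kT (kT (kT kP)))) s := by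
  have h : ∀ n, 0 < kterm (kT (kT (kT (kT kP)))) n s := by
    intro n
    have : 0 < (kT (kT (kT (kT kP)))).eval (kz n s) := by
      rw [P4_eval]
      refine mul_pos (kz_pos n s) ?_
      cases n with
      | zero => exact P4_small _ (kz_zero_ge s hs) hz
      | succ n => exact P4_big _ (kz_ge n s hs)
    unfold kterm; positivity
  exact (kterm_summable _ s).tsum_pos (fun n => (h n).le) 0 (h 0)

lemma main_big (s : ℝ) (hs : 0 < s) (hz : 4.25 ≤ kz 0 s) :
    0 < s * kF (kT (kT kP)) s - kF (kT kP) s := by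
  have key : ∀ n, 0 < s * (kT (kT kP)).eval (kz n s) - (kT kP).eval (kz n s) := by
    intro n
    rw [P1_eval, P2_eval]
    set z := kz n s with hzd
    have hzp : 0 < z := kz_pos n s
    have hz4 : 4.25 ≤ z := by
      cases n with
      | zero => exact hz
      | succ n => have := kz_ge n s hs.le; norm_num at *; linarith
    have hA : 0 < 8 * z ^ 2 - 30 * z + 15 := by norm_num at hz4; nlinarith
    suffices 0 < s * (32 * z ^ 3 - 224 * z ^ 2 + 330 * z - 75) + (8 * z ^ 2 - 30 * z + 15) by
      have := mul_pos hzp this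
      linarith
    rcases le_or_gt 0 (32 * z ^ 3 - 224 * z ^ 2 + 330 * z - 75) with hB | hB
    · have := mul_nonneg hs.le hB
      linarith
    · have hsz : 12.56 * s ≤ z - 3.14 := by
        have h1 := Real.add_one_le_exp (4 * s)
        have h2 := Real.pi_gt_d2
        have h3 : 3.14 ≤ kf n := by
          have hn : (0 : ℝ) ≤ n := n.cast_nonneg
          have : Real.pi * 1 ≤ Real.pi * ((n : ℝ) + 1) ^ 2 := by
            gcongr; nlinarith
          unfold kf; linarith
        have h4 : (3.14 : ℝ) * (4 * s + 1) ≤ kz n s :=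
          mul_le_mul h3 h1 (by positivity) (kf_pos n).le
        norm_num at *; linarith
      have h6 : (z - 3.14) * (32 * z ^ 3 - 224 * z ^ 2 + 330 * z - 75) ≤
        12.56 * s * (32 * z ^ 3 - 224 * z ^ 2 + 330 * z - 75) :=
        mul_le_mul_of_nonpos_right hsz hB.le
      have h7 : 0 < 12.56 * (8 * z ^ 2 - 30 * z + 15) +
          (z - 3.14) * (32 * z ^ 3 - 224 * z ^ 2 + 330 * z - 75) := by
        obtain ⟨w, hw⟩ : ∃ w, z = 4.25 + w := ⟨z - 4.25, by ring⟩
        have hw0 : 0 ≤ w := by linarith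
        rw [hw]
        have : 12.56 * (8 * (4.25 + w) ^ 2 - 30 * (4.25 + w) + 15) +
          (4.25 + w - 3.14) * (32 * (4.25 + w) ^ 3 - 224 * (4.25 + w) ^ 2 + 330 * (4.25 + w) - 75)
          = 111.1 + 392.88 * w + 464.72 * w ^ 2 + 219.52 * w ^ 3 + 32 * w ^ 4 := by ring
        rw [this]; positivity
      linarith
  have e : s * kF (kT (kT kP)) s - kF (kT kP) s =
      ∑' n, (s * kterm (kT (kT kP)) n s - kterm (kT kP) n s) := by
    rw [((kterm_summable _ s).mul_left s).tsum_sub (kterm_summable _ s), tsum_mul_left]; rfl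
  rw [e]
  have hpos : ∀ n, 0 < s * kterm (kT (kT kP)) n s - kterm (kT kP) n s := by
    intro n
    have := mul_pos (mul_pos (Real.exp_pos s) (key n)) (Real.exp_pos (-(kz n s)))
    unfold kterm; linarith
  exact (((kterm_summable _ s).mul_left s).sub (kterm_summable _ s)).tsum_pos
    (fun n => (hpos n).le) 0 (hpos 0)

lemma kz_mono {r s : ℝ} (h : r ≤ s) : kz 0 r ≤ kz 0 s := by
  rw [kz_zero, kz_zero]; gcongr

lemma main_small (s : ℝ) (hs : 0 < s) (hz : kz 0 s ≤ 4.25) :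
    0 < s * kF (kT (kT kP)) s - kF (kT kP) s := by
  have h3 : ∀ r ∈ Set.Ioc 0 s, 0 < kF (kT (kT (kT kP))) r := by
    intro r hr
    have : StrictMonoOn (kF (kT (kT (kT kP)))) (Set.Icc 0 r) := by
      refine strictMonoOn_of_deriv_pos (convex_Icc _ _)
        (fun x _ => (kF_deriv _ x).continuousAt.continuousWithinAt) fun x hx => ?_
      rw [interior_Icc] at hx
      rw [(kF_deriv _ x).deriv]
      exact phi4_pos x hx.1.le ((kz_mono (hx.2.le.trans hr.2)).trans hz)
    have := this ⟨le_rfl, hr.1.le⟩ ⟨hr.1.le, le_rfl⟩ hr.1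
    rwa [phi3_zero] at this
  have hd : ∀ r, HasDerivAt (fun r => r * kF (kT (kT kP)) r - kF (kT kP) r)
      (r * kF (kT (kT (kT kP))) r) r := fun r =>
    (((hasDerivAt_id r).mul (kF_deriv _ r)).sub (kF_deriv _ r)).congr_deriv (by simp)
  have : StrictMonoOn (fun r => r * kF (kT (kT kP)) r - kF (kT kP) r) (Set.Icc 0 s) := by
    refine strictMonoOn_of_deriv_pos (convex_Icc _ _)
      (fun x _ => (hd x).continuousAt.continuousWithinAt) fun x hx => ?_
    rw [interior_Icc] at hx
    rw [(hd x).deriv]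
    exact mul_pos hx.1 (h3 x ⟨hx.1, hx.2.le⟩)
  have := this ⟨le_rfl, hs.le⟩ ⟨hs.le, le_rfl⟩ hs
  simpa [phi1_zero] using this

lemma main_pos (s : ℝ) (hs : 0 < s) : 0 < s * kF (kT (kT kP)) s - kF (kT kP) s := by
  rcases le_total (kz 0 s) 4.25 with h | h
  · exact main_small s hs h
  · exact main_big s hs h

/-- First derivative of `Φ(√t)`, continuously extended to `0`. -/
def g1 (t : ℝ) : ℝ := dslope (kF (kT kP)) 0 (Real.sqrt t) / 2

/-- Second derivative of `Φ(√t)`. -/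
def g2 (t : ℝ) : ℝ :=
  (Real.sqrt t * kF (kT (kT kP)) (Real.sqrt t) - kF (kT kP) (Real.sqrt t)) / (4 * Real.sqrt t ^ 3)

lemma g1_eq {t : ℝ} (ht : 0 < t) : g1 t = kF (kT kP) (Real.sqrt t) / (2 * Real.sqrt t) := by
  have hs := Real.sqrt_pos.mpr ht
  unfold g1
  rw [dslope_of_ne _ hs.ne', slope_def_field, phi1_zero, sub_zero, sub_zero]
  field_simp

lemma g0_deriv {t : ℝ} (ht : 0 < t) : HasDerivAt (fun t => kF kP (Real.sqrt t)) (g1 t) t := by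
  have h := (kF_deriv kP (Real.sqrt t)).comp t (Real.hasDerivAt_sqrt ht.ne')
  refine h.congr_deriv ?_
  rw [g1_eq ht]; ring

lemma g1_deriv {t : ℝ} (ht : 0 < t) : HasDerivAt g1 (g2 t) t := by
  have hs := Real.sqrt_pos.mpr ht
  have h1 := Real.hasDerivAt_sqrt ht.ne'
  have h := ((kF_deriv (kT kP) (Real.sqrt t)).comp t h1).div (h1.const_mul 2) (by positivity)
  have h2 : HasDerivAt g1 _ t := h.congr_of_eventuallyEq (by
    filter_upwards [lt_mem_nhds ht] with u hu
    exact g1_eq hu)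
  refine h2.congr_deriv ?_
  unfold g2
  simp only [Function.comp]
  field_simp
  ring

lemma g2_pos {t : ℝ} (ht : 0 < t) : 0 < g2 t := by
  have hs := Real.sqrt_pos.mpr ht
  exact div_pos (main_pos _ hs) (by positivity)

lemma g1_cont0 : ContinuousAt g1 0 := by
  have h1 : ContinuousAt (dslope (kF (kT kP)) 0) (Real.sqrt 0) := by
    rw [Real.sqrt_zero]
    exact continuousAt_dslope_same.mpr (kF_deriv _ 0).differentiableAt
  exact (ContinuousAt.comp (f := Real.sqrt) h1 Real.continuous_sqrt.continuousAt).div_const 2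

lemma kF_cont (P : ℝ[X]) : Continuous (kF P) :=
  continuous_iff_continuousAt.mpr fun s => (kF_deriv P s).continuousAt

lemma kF_sqrt_decay (P : ℝ[X]) : ∃ K : ℝ, 0 ≤ K ∧ ∀ t, 0 ≤ t →
    |kF P (Real.sqrt t)| ≤ K * Real.exp (-t) := by
  obtain ⟨K, hK, h⟩ := kF_decay P
  refine ⟨K, hK, fun t ht => ?_⟩
  have := h _ (Real.sqrt_nonneg t)
  rwa [Real.sq_sqrt ht] at this

lemma kF_sqrt_lim (P : ℝ[X]) : Tendsto (fun t => kF P (Real.sqrt t)) atTop (𝓝 0) := by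
  obtain ⟨K, hK, h⟩ := kF_sqrt_decay P
  refine squeeze_zero_norm' (a := fun t => K * Real.exp (-t)) ?_ ?_
  · filter_upwards [eventually_ge_atTop 0] with t ht
    exact h t ht
  · simpa using Real.tendsto_exp_neg_atTop_nhds_zero.const_mul K

lemma g1_lim : Tendsto g1 atTop (𝓝 0) := by
  have h1 : Tendsto (fun t => 2 * Real.sqrt t) atTop atTop :=
    Real.tendsto_sqrt_atTop.const_mul_atTop (by norm_num)
  have := (kF_sqrt_lim (kT kP)).div_atTop h1
  refine this.congr' ?_
  filter_upwards [eventually_gt_atTop 0] with t ht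
  exact (g1_eq ht).symm

open MeasureTheory Set

lemma g0_int : IntegrableOn (fun t => kF kP (Real.sqrt t)) (Ioi 0) := by
  obtain ⟨K, hK, h⟩ := kF_sqrt_decay kP
  have h1 : IntegrableOn (fun t : ℝ => K * Real.exp (-t)) (Ioi 0) :=
    (integrableOn_exp_neg_Ioi 0).const_mul K
  refine Integrable.mono' h1 ((kF_cont kP).comp Real.continuous_sqrt).aestronglyMeasurable ?_
  filter_upwards [ae_restrict_mem measurableSet_Ioi] with t ht
  exact h t (le_of_lt ht)

lemma g2_int : IntegrableOn g2 (Ioi 0) :=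
  integrableOn_Ioi_deriv_of_nonneg g1_cont0.continuousWithinAt (fun _ hx => g1_deriv hx)
    (fun _ hx => (g2_pos hx).le) g1_lim

lemma cos_int (x : ℝ) (hx : x ≠ 0) :
    0 < ∫ t in Ioi (0 : ℝ), kF kP (Real.sqrt t) * Real.cos (x * t) := by
  have hc : Continuous fun t : ℝ => Real.cos (x * t) := by fun_prop
  have i1 : IntegrableOn (fun t => kF kP (Real.sqrt t) * Real.cos (x * t)) (Ioi 0) :=
    Integrable.mul_bdd (c := 1) g0_int hc.aestronglyMeasurable
      (Eventually.of_forall fun t => Real.abs_cos_le_one _)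
  have i2 : IntegrableOn (fun t => g2 t * (1 - Real.cos (x * t))) (Ioi 0) :=
    Integrable.mul_bdd (c := 2) g2_int (continuous_const.sub hc).aestronglyMeasurable
      (Eventually.of_forall fun t => by
        rw [Real.norm_eq_abs, abs_le]
        constructor <;> linarith [Real.neg_one_le_cos (x * t), Real.cos_le_one (x * t)])
  have i3 := i2.div_const (x ^ 2)
  have hmul : ∀ t : ℝ, HasDerivAt (fun t => x * t) x t := fun t => by
    simpa using (hasDerivAt_id t).const_mul x
  have hd : ∀ t ∈ Ioi (0 : ℝ), HasDerivAt
      (fun t => kF kP (Real.sqrt t) * Real.sin (x * t) / x - g1 t * (1 - Real.cos (x * t)) / x ^ 2)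
      (kF kP (Real.sqrt t) * Real.cos (x * t) - g2 t * (1 - Real.cos (x * t)) / x ^ 2) t := by
    intro t ht
    have e1 := ((g0_deriv ht).mul (hmul t).sin).div_const x
    have e2 := ((g1_deriv ht).mul ((hmul t).cos.const_sub 1)).div_const (x ^ 2)
    refine (e1.sub e2).congr_deriv ?_
    field_simp
    ring
  have c0 : ContinuousAt (fun t => kF kP (Real.sqrt t)) 0 :=
    ((kF_cont kP).comp Real.continuous_sqrt).continuousAt
  have hcont : ContinuousAt (fun t => kF kP (Real.sqrt t) * Real.sin (x * t) / x
      - g1 t * (1 - Real.cos (x * t)) / x ^ 2) 0 :=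
    ((c0.mul (Continuous.continuousAt (by fun_prop))).div_const x).sub
      ((g1_cont0.mul (Continuous.continuousAt (by fun_prop))).div_const _)
  have hlim : Tendsto (fun t => kF kP (Real.sqrt t) * Real.sin (x * t) / x
      - g1 t * (1 - Real.cos (x * t)) / x ^ 2) atTop (𝓝 0) := by
    have b1 : Tendsto (fun t => kF kP (Real.sqrt t) * Real.sin (x * t)) atTop (𝓝 0) := by
      refine squeeze_zero_norm (a := fun t => |kF kP (Real.sqrt t)|) (fun t => ?_)
        (by simpa using (kF_sqrt_lim kP).abs)
      rw [Real.norm_eq_abs, abs_mul]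
      exact mul_le_of_le_one_right (abs_nonneg _) (Real.abs_sin_le_one _)
    have b2 : Tendsto (fun t => g1 t * (1 - Real.cos (x * t))) atTop (𝓝 0) := by
      refine squeeze_zero_norm (a := fun t => |g1 t| * 2) (fun t => ?_)
        (by simpa using g1_lim.abs.mul_const 2)
      rw [Real.norm_eq_abs, abs_mul]
      gcongr
      rw [abs_le]
      constructor <;> linarith [Real.neg_one_le_cos (x * t), Real.cos_le_one (x * t)]
    simpa using (b1.div_const x).sub (b2.div_const (x ^ 2))
  have key := integral_Ioi_of_hasDerivAt_of_tendsto hcont.continuousWithinAt hd (i1.sub i3) hlim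
  rw [integral_sub i1 i3] at key
  simp only [mul_zero, Real.sin_zero, Real.cos_zero, sub_self, zero_div] at key
  have pos : 0 < ∫ t in Ioi (0 : ℝ), g2 t * (1 - Real.cos (x * t)) / x ^ 2 := by
    have hnn : ∀ t ∈ Ioi (0 : ℝ), 0 ≤ g2 t * (1 - Real.cos (x * t)) / x ^ 2 := fun t ht => by
      have h1 := g2_pos ht
      have h2 : 0 ≤ 1 - Real.cos (x * t) := by linarith [Real.cos_le_one (x * t)]
      positivity
    rw [setIntegral_pos_iff_support_of_nonneg_ae
      ((ae_restrict_mem measurableSet_Ioi).mono hnn) i3]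
    have hxa : 0 < |x| := abs_pos.mpr hx
    have hsub : Ioo (0 : ℝ) (1 / |x|) ⊆
        Function.support (fun t => g2 t * (1 - Real.cos (x * t)) / x ^ 2) ∩ Ioi 0 := by
      intro t ht
      refine ⟨?_, ht.1⟩
      have h1 := g2_pos ht.1
      have h3 : |x * t| < 1 := by
        rw [abs_mul, abs_of_pos ht.1]
        have := ht.2
        rw [lt_div_iff₀ hxa] at this
        linarith
      have h4 := abs_lt.mp h3
      have h5 : Real.cos (x * t) ≠ 1 := by
        intro h
        rw [Real.cos_eq_one_iff_of_lt_of_lt (by linarith [Real.pi_gt_three])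
          (by linarith [Real.pi_gt_three])] at h
        exact (mul_ne_zero hx ht.1.ne') h
      have h6 : 1 - Real.cos (x * t) ≠ 0 := sub_ne_zero.mpr (Ne.symm h5)
      exact div_ne_zero (mul_ne_zero h1.ne' h6) (pow_ne_zero 2 hx)
    refine lt_of_lt_of_le ?_ (measure_mono hsub)
    rw [Real.volume_Ioo]
    simpa using hx
  linarith

lemma zero_int : 0 < ∫ t in Ioi (0 : ℝ), kF kP (Real.sqrt t) := by
  have hnn : ∀ t ∈ Ioi (0 : ℝ), 0 ≤ kF kP (Real.sqrt t) :=
    fun t _ => (phi_pos _ (Real.sqrt_nonneg t)).le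
  rw [setIntegral_pos_iff_support_of_nonneg_ae
      ((ae_restrict_mem measurableSet_Ioi).mono hnn) g0_int]
  have hsub : Ioi (0 : ℝ) ⊆ Function.support (fun t => kF kP (Real.sqrt t)) ∩ Ioi 0 :=
    fun t ht => ⟨(phi_pos _ (Real.sqrt_nonneg t)).ne', ht⟩
  refine lt_of_lt_of_le ?_ (measure_mono hsub)
  simp

end

/-- **Theorem 4.4.** The function `t ↦ Φ(√t)` is strictly convex for `t > 0` and
consequently `∫₀^∞ Φ(√t)·cos(xt) dt > 0` for all `x ∈ ℝ`. -/
theorem thm_4_4 :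
    (∀ t : ℝ, 0 < t → 0 < iteratedDeriv 2 (fun u => jacobiPhi (Real.sqrt u)) t) ∧
    (∀ x : ℝ, 0 < ∫ t in Set.Ioi (0 : ℝ), jacobiPhi (Real.sqrt t) * Real.cos (x * t)) := by
  rw [phi_eq]
  constructor
  · intro t ht
    rw [iteratedDeriv_succ, iteratedDeriv_one]
    have h : deriv (fun u => kF kP (Real.sqrt u)) =ᶠ[𝓝 t] g1 := by
      filter_upwards [lt_mem_nhds ht] with u hu
      exact (g0_deriv hu).deriv
    rw [h.deriv_eq, (g1_deriv ht).deriv]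
    exact g2_pos ht
  · intro x
    rcases eq_or_ne x 0 with rfl | hx
    · simpa using zero_int
    · exact cos_int x hx
end

section
/- The Jacobi theta kernel Φ is an admissible kernel whose logarithm is strictly concave on (0, ∞) (i.e. (d²/dt²) log Φ(t) < 0 for t > 0). Moreover, for each n ∈ ℕ₀ the associated kernel Kₙ(t; Φ) := ∫_{−∞}^{∞} Φ(s+t)·Φ(s−t)·s^{2n} ds is also an admissible kernel. -/
/-- A function `K : ℝ → ℝ` is an admissible kernel if it is smooth, positive, even,
strictly decreasing on `(0, ∞)`, and all of its derivatives decay like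
`exp(−|t|^{2+ε})` for some `ε > 0` as `|t| → ∞`. -/
def AdmissibleKernel (K : ℝ → ℝ) : Prop :=
  ContDiff ℝ (⊤ : ℕ∞) K ∧ (∀ t : ℝ, 0 < K t) ∧ (∀ t : ℝ, K (-t) = K t) ∧
    (∀ t : ℝ, 0 < t → deriv K t < 0) ∧
    ∃ ε : ℝ, 0 < ε ∧ ∀ n : ℕ,
      (iteratedDeriv n K) =O[Filter.cocompact ℝ] fun t => Real.exp (-|t| ^ (2 + ε))

/-- The associated kernel `Kₙ(t; Φ) := ∫ Φ(s+t)·Φ(s−t)·s^{2n} ds`. -/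
noncomputable def assocKernelPhi (n : ℕ) (t : ℝ) : ℝ :=
  ∫ s : ℝ, jacobiPhi (s + t) * jacobiPhi (s - t) * s ^ (2 * n)

namespace JPhi
open Real Polynomial Filter

noncomputable def trm (P : ℝ[X]) (n : ℕ) (t : ℝ) : ℝ :=
  P.eval (π * ((n : ℝ) + 1) ^ 2 * exp (4 * t)) * exp (t - π * ((n : ℝ) + 1) ^ 2 * exp (4 * t))

noncomputable def FF (P : ℝ[X]) (t : ℝ) : ℝ := ∑' n : ℕ, trm P n t

noncomputable def TT (P : ℝ[X]) : ℝ[X] := 4 * X * derivative P + P - 4 * X * P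

lemma poly_bound (P : ℝ[X]) : ∃ C : ℝ, 0 ≤ C ∧ ∀ y : ℝ, 0 ≤ y → |P.eval y| ≤ C * exp (y / 2) := by
  induction P using Polynomial.induction_on' with
  | add p q hp hq =>
    obtain ⟨C, hC, h1⟩ := hp
    obtain ⟨D, hD, h2⟩ := hq
    refine ⟨C + D, by positivity, fun y hy => ?_⟩
    rw [eval_add, add_mul]
    exact (abs_add_le _ _).trans (add_le_add (h1 y hy) (h2 y hy))
  | monomial n a =>
    refine ⟨|a| * (2 ^ n * n.factorial), by positivity, fun y hy => ?_⟩
    have h := Real.pow_div_factorial_le_exp (y / 2) (by positivity) n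
    rw [eval_monomial, abs_mul, abs_of_nonneg (pow_nonneg hy n), mul_assoc]
    refine mul_le_mul_of_nonneg_left ?_ (abs_nonneg a)
    rw [div_le_iff₀ (by positivity), div_pow, div_le_iff₀ (by positivity)] at h
    linarith

lemma trm_bound {P : ℝ[X]} {C : ℝ} (hC : 0 ≤ C)
    (h : ∀ y : ℝ, 0 ≤ y → |P.eval y| ≤ C * exp (y / 2)) (n : ℕ) (t : ℝ) :
    ‖trm P n t‖ ≤ C * exp t * exp (-(π / 2 * exp (4 * t)) * (n + 1)) := by
  unfold trm
  rw [norm_mul, Real.norm_eq_abs, Real.norm_eq_abs, abs_of_pos (exp_pos (t - _))]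
  have h1 := h (π * ((n : ℝ) + 1) ^ 2 * exp (4 * t)) (by positivity)
  refine (mul_le_mul_of_nonneg_right h1 (exp_pos _).le).trans ?_
  rw [mul_assoc C, mul_assoc C, ← exp_add, ← exp_add]
  refine mul_le_mul_of_nonneg_left (exp_le_exp.2 ?_) hC
  have h2 : (n : ℝ) + 1 ≤ ((n : ℝ) + 1) ^ 2 := by nlinarith [(Nat.cast_nonneg n : (0:ℝ) ≤ n)]
  have h3 : 0 < π / 2 * exp (4 * t) := by positivity
  nlinarith

lemma summable_geo {c : ℝ} (hc : 0 < c) : Summable fun n : ℕ => exp (-c * ((n : ℝ) + 1)) := by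
  have h : Summable fun n : ℕ => exp (-c) * (exp (-c)) ^ n :=
    (summable_geometric_of_lt_one (exp_pos _).le (by rw [exp_lt_one_iff]; linarith)).mul_left _
  refine h.congr fun n => ?_
  rw [← exp_nat_mul, ← exp_add]; congr 1; ring

lemma trm_summable (P : ℝ[X]) (t : ℝ) : Summable fun n => trm P n t := by
  obtain ⟨C, hC, h⟩ := poly_bound P
  exact Summable.of_norm_bounded ((summable_geo (by positivity)).mul_left _)
    (fun n => trm_bound hC h n t)

lemma trm_deriv (P : ℝ[X]) (n : ℕ) (t : ℝ) : HasDerivAt (trm P n) (trm (TT P) n t) t := by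
  have h1 : HasDerivAt (fun t : ℝ => π * ((n : ℝ) + 1) ^ 2 * exp (4 * t))
      (4 * (π * ((n : ℝ) + 1) ^ 2 * exp (4 * t))) t := by
    have := (((hasDerivAt_id t).const_mul 4).exp).const_mul (π * ((n : ℝ) + 1) ^ 2)
    refine this.congr_deriv ?_
    simp only [id]; ring
  have h2 := (P.hasDerivAt _).comp t h1
  have h3 := ((hasDerivAt_id t).sub h1).exp
  refine (h2.mul h3).congr_deriv ?_
  simp only [trm, TT, eval_sub, eval_add, eval_mul, eval_X, Function.comp]
  simp
  ring

lemma FF_deriv (P : ℝ[X]) (t : ℝ) : HasDerivAt (FF P) (FF (TT P) t) t := by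
  obtain ⟨C, hC, h⟩ := poly_bound (TT P)
  refine hasDerivAt_tsum_of_isPreconnected (t := Set.Ioo (t - 1) (t + 1)) (y₀ := t)
    (u := fun n : ℕ => C * exp (t + 1) * exp (-(π / 2 * exp (4 * (t - 1))) * (n + 1)))
    ((summable_geo (by positivity)).mul_left _) isOpen_Ioo isPreconnected_Ioo
    (fun n y _ => trm_deriv P n y) (fun n y hy => ?_) (by simp) (trm_summable P t) (by simp)
  refine (trm_bound hC h n y).trans ?_
  have h4 : exp (4 * (t - 1)) ≤ exp (4 * y) := exp_le_exp.2 (by linarith [hy.1])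
  have h5 : exp y ≤ exp (t + 1) := exp_le_exp.2 hy.2.le
  refine mul_le_mul (mul_le_mul_of_nonneg_left h5 hC) (exp_le_exp.2 ?_) (exp_pos _).le (by positivity)
  simp only [neg_mul, neg_le_neg_iff]
  gcongr

lemma FF_bound (P : ℝ[X]) : ∃ C : ℝ, 0 ≤ C ∧ ∀ t : ℝ, 0 ≤ t → |FF P t| ≤ C * exp (-t ^ 3) := by
  obtain ⟨C, hC, h⟩ := poly_bound P
  have hs : Summable fun n : ℕ => exp (-1 * (n : ℝ)) := by
    refine (summable_geometric_of_lt_one (exp_pos (-1)).le (by rw [exp_lt_one_iff]; linarith)).congr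
      fun n => ?_
    rw [← exp_nat_mul]; congr 1; ring
  refine ⟨C * ∑' n : ℕ, exp (-1 * (n : ℝ)), mul_nonneg hC (tsum_nonneg fun _ => (exp_pos _).le),
    fun t ht => ?_⟩
  have := tsum_of_norm_bounded (f := fun n => trm P n t)
    ((hs.hasSum).mul_left (C * exp (-t ^ 3))) (fun n => ?_)
  · rw [Real.norm_eq_abs] at this
    unfold FF
    linarith
  · refine (trm_bound hC h n t).trans ?_
    rw [mul_assoc, mul_assoc, ← exp_add, ← exp_add]
    refine mul_le_mul_of_nonneg_left (exp_le_exp.2 ?_) hC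
    have e1 := Real.pow_div_factorial_le_exp (4 * t) (by positivity) 3
    have e2 := Real.add_one_le_exp (4 * t)
    have e3 : (Nat.factorial 3 : ℝ) = 6 := by norm_num [Nat.factorial]
    rw [e3] at e1
    have hp := pi_gt_three
    have ht3 : 0 ≤ t ^ 3 := by positivity
    have e4 : t + t ^ 3 ≤ exp (4 * t) := by nlinarith
    have e5 : exp (4 * t) ≤ π / 2 * exp (4 * t) := by nlinarith [exp_pos (4 * t)]
    have e6 : (n : ℝ) ≤ π / 2 * exp (4 * t) * n :=
      le_mul_of_one_le_left (Nat.cast_nonneg n) (by nlinarith)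
    nlinarith

lemma FF_iter (P : ℝ[X]) (k : ℕ) : iteratedDeriv k (FF P) = FF (TT^[k] P) := by
  induction k with
  | zero => simp
  | succ k ih =>
    rw [iteratedDeriv_succ, ih, Function.iterate_succ_apply']
    exact funext fun t => (FF_deriv _ t).deriv

lemma FF_contDiff (P : ℝ[X]) : ContDiff ℝ (⊤ : ℕ∞) (FF P) := by
  rw [contDiff_infty]
  intro n
  induction n generalizing P with
  | zero => 
    exact contDiff_zero.2 (continuous_iff_continuousAt.2 fun t => (FF_deriv P t).continuousAt)
  | succ n ih =>
    push_cast
    refine contDiff_succ_iff_deriv.2 ⟨fun t => (FF_deriv P t).differentiableAt, by simp, ?_⟩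
    rw [show deriv (FF P) = FF (TT P) from funext fun t => (FF_deriv _ t).deriv]
    exact ih _

noncomputable def P0 : ℝ[X] := 2 * X ^ 2 - 3 * X

lemma phi_eq : jacobiPhi = FF P0 := by
  funext t
  unfold jacobiPhi FF
  refine tsum_congr fun n => ?_
  unfold trm P0
  rw [show (5 * t - π * ((n : ℝ) + 1) ^ 2 * exp (4 * t)) =
    4 * t + (t - π * ((n : ℝ) + 1) ^ 2 * exp (4 * t)) by ring, exp_add (4 * t)]
  simp
  ring

lemma FF_one (t : ℝ) :
    exp t * ∑' n : ℤ, exp (-π * exp (4 * t) * (n : ℝ) ^ 2) = exp t + 2 * FF 1 t := by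
  have hs := (trm_summable 1 t).mul_left (exp (-t))
  have e : ∀ n : ℕ, exp (-t) * trm 1 n t = exp (-π * exp (4 * t) * ((n : ℝ) + 1) ^ 2) := by
    intro n
    simp only [trm, eval_one, one_mul]
    rw [← exp_add]; congr 1; ring
  rw [summable_congr e] at hs
  have hs0 : Summable fun n : ℕ => exp (-π * exp (4 * t) * (n : ℝ) ^ 2) := by
    rw [← summable_nat_add_iff 1]
    simpa using hs
  have hF : ∑' n : ℕ, exp (-π * exp (4 * t) * ((n : ℝ) + 1) ^ 2) = exp (-t) * FF 1 t := by
    unfold FF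
    rw [← tsum_mul_left]
    exact (tsum_congr e).symm
  rw [tsum_of_nat_of_neg_add_one (by simpa using hs0)
    (by refine hs.congr fun n => ?_
        congr 1; push_cast; ring)]
  have h1 : ∑' n : ℕ, exp (-π * exp (4 * t) * (((n : ℕ) : ℤ) : ℝ) ^ 2) = 1 + exp (-t) * FF 1 t := by
    rw [Summable.tsum_eq_zero_add (by simpa using hs0), ← hF]
    simp
  have h2 : ∑' n : ℕ, exp (-π * exp (4 * t) * ((-((n : ℤ) + 1) : ℤ) : ℝ) ^ 2) = exp (-t) * FF 1 t := by
    rw [← hF]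
    refine tsum_congr fun n => ?_
    congr 1; push_cast; ring
  rw [h1, h2]
  have : exp t * exp (-t) = 1 := by rw [← exp_add]; simp
  linear_combination (2 * FF 1 t) * this

lemma h_even (t : ℝ) : exp (-t) + 2 * FF 1 (-t) = exp t + 2 * FF 1 t := by
  rw [← FF_one, ← FF_one, Real.tsum_exp_neg_mul_int_sq (exp_pos (4 * t)), ← mul_assoc]
  congr 1
  · rw [← Real.exp_mul, one_div, ← exp_neg, ← exp_add]; congr 1; ring
  · refine tsum_congr fun n => ?_
    congr 2
    rw [show 4 * -t = -(4 * t) by ring, exp_neg, div_eq_mul_inv]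

lemma FF_add (P Q : ℝ[X]) (t : ℝ) : FF (P + Q) t = FF P t + FF Q t := by
  unfold FF
  rw [← (trm_summable P t).tsum_add (trm_summable Q t)]
  exact tsum_congr fun n => by simp [trm, add_mul]

lemma FF_C_mul (c : ℝ) (P : ℝ[X]) (t : ℝ) : FF (C c * P) t = c * FF P t := by
  unfold FF
  rw [← tsum_mul_left]
  exact tsum_congr fun n => by simp [trm, mul_assoc]

lemma TT_one : TT (TT 1) = 1 + C 8 * P0 := by
  have : (C 8 : ℝ[X]) = 8 := rfl
  simp [TT, P0, this]
  ring

lemma FF_P0 (t : ℝ) : 8 * FF P0 t = FF (TT (TT 1)) t - FF 1 t := by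
  rw [TT_one, FF_add, FF_C_mul]; ring

lemma phi_even (t : ℝ) : jacobiPhi (-t) = jacobiPhi t := by
  have d1 : ∀ P t, HasDerivAt (fun t => FF P (-t)) (-FF (TT P) (-t)) t := fun P t => by
    have := (FF_deriv P (-t)).comp t (hasDerivAt_neg t)
    exact this.congr_deriv (by ring)
  have e1 : ∀ t : ℝ, HasDerivAt (fun t => exp (-t)) (-exp (-t)) t := fun t => by
    have := (hasDerivAt_neg t).exp
    exact this.congr_deriv (by ring)
  have A : ∀ t : ℝ, -exp (-t) + 2 * (-FF (TT 1) (-t)) = exp t + 2 * FF (TT 1) t := fun t =>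
    HasDerivAt.unique ((e1 t).add ((d1 1 t).const_mul 2))
      (by rw [show ((fun t => exp (-t)) + fun y => 2 * FF 1 (-y)) = fun t => exp t + 2 * FF 1 t from funext h_even]
          exact (Real.hasDerivAt_exp t).add ((FF_deriv 1 t).const_mul 2))
  have B : -(-exp (-t)) + 2 * (-(-FF (TT (TT 1)) (-t))) = exp t + 2 * FF (TT (TT 1)) t := 
    HasDerivAt.unique ((e1 t).neg.add ((d1 (TT 1) t).neg.const_mul 2))
      (by rw [show (-(fun t => exp (-t)) + fun y => 2 * (-fun t => FF (TT 1) (-t)) y) = fun t => exp t + 2 * FF (TT 1) t from funext A]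
          exact (Real.hasDerivAt_exp t).add ((FF_deriv (TT 1) t).const_mul 2))
  have := h_even t
  have p1 := FF_P0 t
  have p2 := FF_P0 (-t)
  rw [phi_eq]
  linarith

lemma phi_pos_nonneg {t : ℝ} (ht : 0 ≤ t) : 0 < jacobiPhi t := by
  rw [phi_eq]
  have key : ∀ n : ℕ, 0 < trm P0 n t := by
    intro n
    unfold trm
    refine mul_pos ?_ (exp_pos _)
    have h1 : 1 ≤ exp (4 * t) := Real.one_le_exp (by linarith)
    have h2 : (1 : ℝ) ≤ ((n : ℝ) + 1) ^ 2 := by nlinarith [(Nat.cast_nonneg n : (0:ℝ) ≤ n)]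
    have hp := pi_gt_three
    have h3 : (3 : ℝ) < π * ((n : ℝ) + 1) ^ 2 * exp (4 * t) := by
      have : π * 1 * 1 ≤ π * ((n : ℝ) + 1) ^ 2 * exp (4 * t) := by gcongr
      linarith
    simp only [P0]
    simp
    nlinarith
  exact (trm_summable P0 t).tsum_pos (fun n => (key n).le) 0 (key 0)

lemma phi_pos (t : ℝ) : 0 < jacobiPhi t := by
  rcases le_total 0 t with h | h
  · exact phi_pos_nonneg h
  · rw [← phi_even]; exact phi_pos_nonneg (by linarith)

lemma TP0_eval (y : ℝ) : (TT P0).eval y = -8 * y ^ 3 + 30 * y ^ 2 - 15 * y := by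
  simp [TT, P0]; ring

lemma TTP0_eval (y : ℝ) :
    (TT (TT P0)).eval y = 32 * y ^ 4 - 224 * y ^ 3 + 330 * y ^ 2 - 75 * y := by
  simp [TT, P0]; ring

lemma Q_ident (z c : ℝ) (hz : 2 * z - 3 ≠ 0) :
    (32 * z ^ 4 - 224 * z ^ 3 + 330 * z ^ 2 - 75 * z)
      - 2 * c * (-8 * z ^ 3 + 30 * z ^ 2 - 15 * z) + c ^ 2 * (2 * z ^ 2 - 3 * z)
      = ((9 + 12 / (2 * z - 3) - 4 * z - c) ^ 2 - (16 * z + 96 * z / (2 * z - 3) ^ 2))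
        * (z * (2 * z - 3)) := by
  obtain ⟨w, rfl⟩ : ∃ w, z = (w + 3) / 2 := ⟨2 * z - 3, by ring⟩
  have e : 2 * ((w + 3) / 2) - 3 = w := by ring
  rw [e] at hz ⊢
  field_simp
  ring

lemma Q_first {y c : ℝ} (hy : 3 ≤ y) (hc : c = 9 + 12 / (2 * y - 3) - 4 * y) :
    (32 * y ^ 4 - 224 * y ^ 3 + 330 * y ^ 2 - 75 * y) - 2 * c * (-8 * y ^ 3 + 30 * y ^ 2 - 15 * y)
      + c ^ 2 * (2 * y ^ 2 - 3 * y) ≤ -16 * y ^ 3 := by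
  have h0 : 0 < 2 * y - 3 := by linarith
  have e : (32 * y ^ 4 - 224 * y ^ 3 + 330 * y ^ 2 - 75 * y)
      - 2 * c * (-8 * y ^ 3 + 30 * y ^ 2 - 15 * y) + c ^ 2 * (2 * y ^ 2 - 3 * y)
      = -(16 * y + 96 * y / (2 * y - 3) ^ 2) * (y * (2 * y - 3)) := by
    rw [Q_ident y c h0.ne', ← hc]; ring
  rw [e]
  have h1 : 0 ≤ 96 * y / (2 * y - 3) ^ 2 := by positivity
  have h2 : 0 ≤ y * (2 * y - 3) := by positivity
  nlinarith [mul_nonneg h1 h2, mul_nonneg (sq_nonneg y) (sub_nonneg.2 hy)]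

lemma Q_rest {y z c : ℝ} (hy : 3 ≤ y) (hz : 2 * y ≤ z) (hc : c = 9 + 12 / (2 * y - 3) - 4 * y) :
    (32 * z ^ 4 - 224 * z ^ 3 + 330 * z ^ 2 - 75 * z) - 2 * c * (-8 * z ^ 3 + 30 * z ^ 2 - 15 * z)
      + c ^ 2 * (2 * z ^ 2 - 3 * z) ≤ 32 * z ^ 4 := by
  have h0 : 0 < 2 * y - 3 := by linarith
  have hz0 : 0 < 2 * z - 3 := by linarith
  have hzp : 0 < z := by linarith
  set d := 9 + 12 / (2 * z - 3) - 4 * z with hd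
  have e : (32 * z ^ 4 - 224 * z ^ 3 + 330 * z ^ 2 - 75 * z)
      - 2 * c * (-8 * z ^ 3 + 30 * z ^ 2 - 15 * z) + c ^ 2 * (2 * z ^ 2 - 3 * z)
      = ((d - c) ^ 2 - (16 * z + 96 * z / (2 * z - 3) ^ 2)) * (z * (2 * z - 3)) := by
    rw [Q_ident z c hz0.ne', ← hd]
  rw [e]
  have b1 : 12 / (2 * y - 3) ≤ 4 := by rw [div_le_iff₀ h0]; linarith
  have b2 : 0 ≤ 12 / (2 * y - 3) := by positivity
  have b3 : 12 / (2 * z - 3) ≤ 4 := by rw [div_le_iff₀ hz0]; linarith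
  have b4 : 0 ≤ 12 / (2 * z - 3) := by positivity
  have h1 : 0 ≤ 96 * z / (2 * z - 3) ^ 2 := by positivity
  have h2 : 0 ≤ z * (2 * z - 3) := by positivity
  have h3 : (d - c) ^ 2 ≤ (4 * z) ^ 2 := by
    apply sq_le_sq'
    · rw [hd, hc]; linarith
    · rw [hd, hc]; linarith
  have h4 : (d - c) ^ 2 - (16 * z + 96 * z / (2 * z - 3) ^ 2) ≤ 16 * z ^ 2 := by nlinarith
  refine (mul_le_mul_of_nonneg_right h4 h2).trans ?_
  have : 0 ≤ z ^ 3 := by positivity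
  nlinarith

lemma tail_bound {y : ℝ} (hy : 3 ≤ y) (k : ℕ) :
    32 * (((k : ℝ) + 2) ^ 2 * y) ^ 4 * exp (-(((k : ℝ) + 2) ^ 2 * y)) ≤
      16 * y ^ 3 * exp (-y) * (512 * exp (-7)) * (1 / 2) ^ k := by
  have hk : (0 : ℝ) ≤ k := Nat.cast_nonneg k
  have h1 : ((k : ℝ) + 2) ^ 8 ≤ 256 * exp (4 * k) := by
    have := Real.add_one_le_exp ((k : ℝ) / 2)
    have h : ((k : ℝ) / 2 + 1) ^ 8 ≤ exp (k / 2) ^ 8 := by gcongr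
    rw [← exp_nat_mul] at h
    rw [show ((8 : ℕ) : ℝ) * ((k : ℝ) / 2) = 4 * k by push_cast; ring] at h
    calc ((k : ℝ) + 2) ^ 8 = 256 * ((k : ℝ) / 2 + 1) ^ 8 := by ring
      _ ≤ _ := by linarith
  have h2 : y ≤ exp (y - 1) := by linarith [Real.add_one_le_exp (y - 1)]
  have h3 : exp (-8 * (k : ℝ)) ≤ (1 / 2) ^ k := by
    rw [show -8 * (k : ℝ) = k * (-8) by ring, exp_nat_mul]
    refine pow_le_pow_left₀ (exp_pos _).le ?_ k
    rw [exp_neg, one_div]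
    refine inv_anti₀ (by norm_num) ?_
    linarith [Real.add_one_le_exp (8 : ℝ)]
  have hy3 : 0 ≤ y ^ 3 := by positivity
  calc 32 * (((k : ℝ) + 2) ^ 2 * y) ^ 4 * exp (-(((k : ℝ) + 2) ^ 2 * y))
      = 32 * y ^ 3 * (((k : ℝ) + 2) ^ 8 * y * exp (-(((k : ℝ) + 2) ^ 2 * y))) := by ring
    _ ≤ 32 * y ^ 3 * ((256 * exp (4 * k)) * exp (y - 1) * exp (-(((k : ℝ) + 2) ^ 2 * y))) := by
        gcongr
    _ = 32 * y ^ 3 * 256 * exp (4 * k + (y - 1) + (-(((k : ℝ) + 2) ^ 2 * y))) := by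
        rw [exp_add, exp_add]; ring
    _ ≤ 32 * y ^ 3 * 256 * exp (-y + -7 + -8 * k) := by
        refine mul_le_mul_of_nonneg_left (exp_le_exp.2 ?_) (by positivity)
        have : (2 + 4 * (k : ℝ)) * 3 ≤ (((k : ℝ) + 2) ^ 2 - 2) * y := by
          apply mul_le_mul _ hy (by norm_num) <;> nlinarith
        nlinarith
    _ = 16 * y ^ 3 * exp (-y) * (512 * exp (-7)) * exp (-8 * k) := by
        rw [exp_add, exp_add]; ring
    _ ≤ _ := by gcongr

lemma exp_seven : 1024 * exp (-7) < 1 := by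
  have h : (2.7 : ℝ) < exp 1 := by linarith [Real.exp_one_gt_d9]
  have h2 : (2.7 : ℝ) ^ 7 < exp 1 ^ 7 := by gcongr
  rw [← exp_nat_mul] at h2
  norm_num at h2
  rw [exp_neg, ← div_eq_mul_inv, div_lt_one (exp_pos _)]
  linarith

lemma key_neg {t : ℝ} (ht : 0 ≤ t) :
    FF (TT (TT P0)) t * FF P0 t - FF (TT P0) t ^ 2 < 0 := by
  set y := π * exp (4 * t) with hyd
  have hy : 3 ≤ y := by nlinarith [pi_gt_three, Real.one_le_exp (show 0 ≤ 4 * t by linarith)]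
  set c := 9 + 12 / (2 * y - 3) - 4 * y with hc
  set Q : ℝ[X] := TT (TT P0) + (C (-2 * c) * TT P0 + C (c ^ 2) * P0) with hQ
  have hQe : ∀ z, Q.eval z = (32 * z ^ 4 - 224 * z ^ 3 + 330 * z ^ 2 - 75 * z)
      - 2 * c * (-8 * z ^ 3 + 30 * z ^ 2 - 15 * z) + c ^ 2 * (2 * z ^ 2 - 3 * z) := by
    intro z
    rw [hQ, eval_add, eval_add, eval_C_mul, eval_C_mul, TP0_eval, TTP0_eval]
    simp only [P0]; simp; ring
  have hFQ : FF Q t = FF (TT (TT P0)) t + (-2 * c * FF (TT P0) t + c ^ 2 * FF P0 t) := by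
    rw [hQ, FF_add, FF_add, FF_C_mul, FF_C_mul]
  have hpos : 0 < 16 * y ^ 3 * exp (t - y) := by positivity
  have hneg : FF Q t < 0 := by
    unfold FF
    rw [(trm_summable Q t).tsum_eq_zero_add]
    have h0 : trm Q 0 t ≤ -(16 * y ^ 3 * exp (t - y)) := by
      unfold trm
      rw [show π * (((0 : ℕ) : ℝ) + 1) ^ 2 * exp (4 * t) = y by rw [hyd]; push_cast; ring, hQe]
      nlinarith [mul_le_mul_of_nonneg_right (Q_first hy hc) (exp_pos (t - y)).le]
    have h1 : ∀ k : ℕ, trm Q (k + 1) t ≤ 16 * y ^ 3 * exp (t - y) * (512 * exp (-7)) * (1 / 2) ^ k := by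
      intro k
      unfold trm
      have hz : π * (((k + 1 : ℕ) : ℝ) + 1) ^ 2 * exp (4 * t) = ((k : ℝ) + 2) ^ 2 * y := by
        rw [hyd]; push_cast; ring
      rw [hz, hQe]
      have hk : (0 : ℝ) ≤ k := Nat.cast_nonneg k
      have hz2 : 2 * y ≤ ((k : ℝ) + 2) ^ 2 * y := by
        apply mul_le_mul_of_nonneg_right _ (by linarith); nlinarith
      have a := mul_le_mul_of_nonneg_right (Q_rest hy hz2 hc) (exp_pos (t - ((k : ℝ) + 2) ^ 2 * y)).le
      refine a.trans ?_
      have b := mul_le_mul_of_nonneg_right (tail_bound hy k) (exp_pos t).le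
      rw [sub_eq_add_neg, exp_add, sub_eq_add_neg, exp_add]
      linarith
    have h2 : Summable fun k : ℕ => 16 * y ^ 3 * exp (t - y) * (512 * exp (-7)) * (1 / 2 : ℝ) ^ k :=
      summable_geometric_two.mul_left _
    have h3 := Summable.tsum_le_tsum h1 ((summable_nat_add_iff 1).2 (trm_summable Q t)) h2
    rw [tsum_mul_left, tsum_geometric_two] at h3
    have := mul_lt_mul_of_pos_left exp_seven hpos
    linarith
  have hP : 0 < FF P0 t := by rw [← phi_eq]; exact phi_pos t
  rw [hFQ] at hneg
  nlinarith [mul_pos hP (neg_pos.2 hneg), sq_nonneg (FF (TT P0) t - c * FF P0 t)]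

noncomputable def phd (k : ℕ) : ℝ → ℝ := FF (TT^[k] P0)

lemma phd_zero : phd 0 = jacobiPhi := phi_eq.symm

lemma phd_deriv (k : ℕ) (t : ℝ) : HasDerivAt (phd k) (phd (k + 1) t) t := by
  unfold phd
  rw [Function.iterate_succ_apply']
  exact FF_deriv _ t

lemma phd_cont (k : ℕ) : Continuous (phd k) :=
  continuous_iff_continuousAt.2 fun t => (phd_deriv k t).continuousAt

lemma phd_iter (k : ℕ) : iteratedDeriv k jacobiPhi = phd k := by
  rw [phi_eq, FF_iter]; rfl

lemma phd_neg (k : ℕ) (t : ℝ) : phd k (-t) = (-1) ^ k * phd k t := by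
  have h := iteratedDeriv_comp_neg k jacobiPhi (-t)
  rw [show (fun x => jacobiPhi (-x)) = jacobiPhi from funext phi_even, phd_iter] at h
  simpa using h

lemma phd_bound (k : ℕ) : ∃ C : ℝ, 0 ≤ C ∧ ∀ t, |phd k t| ≤ C * exp (-|t| ^ 3) := by
  obtain ⟨C, hC, h⟩ := FF_bound (TT^[k] P0)
  refine ⟨C, hC, fun t => ?_⟩
  have h1 : |phd k t| = |phd k (|t|)| := by
    rcases abs_choice t with e | e <;> rw [e]
    rw [phd_neg, abs_mul]; simp
  rw [h1]
  exact h |t| (abs_nonneg t)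

noncomputable def uu (t : ℝ) : ℝ := phd 1 t / phd 0 t

lemma phd0_pos (t : ℝ) : 0 < phd 0 t := by rw [phd_zero]; exact phi_pos t

lemma uu_deriv (t : ℝ) :
    HasDerivAt uu ((phd 2 t * phd 0 t - phd 1 t * phd 1 t) / phd 0 t ^ 2) t :=
  (phd_deriv 1 t).div (phd_deriv 0 t) (phd0_pos t).ne'

lemma uu_deriv_neg' {t : ℝ} (ht : 0 ≤ t) :
    (phd 2 t * phd 0 t - phd 1 t * phd 1 t) / phd 0 t ^ 2 < 0 := by
  refine div_neg_of_neg_of_pos ?_ (pow_pos (phd0_pos t) 2)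
  have := key_neg ht
  simp only [phd, Function.iterate_succ_apply, Function.iterate_zero_apply]
  linarith

lemma uu_deriv_neg (t : ℝ) :
    (phd 2 t * phd 0 t - phd 1 t * phd 1 t) / phd 0 t ^ 2 < 0 := by
  rcases le_total 0 t with h | h
  · exact uu_deriv_neg' h
  · have := uu_deriv_neg' (t := -t) (by linarith)
    simpa [phd_neg] using this

lemma uu_anti : StrictAnti uu :=
  strictAnti_of_deriv_neg fun t => by rw [(uu_deriv t).deriv]; exact uu_deriv_neg t

lemma phi_deriv_neg {t : ℝ} (ht : 0 < t) : deriv jacobiPhi t < 0 := by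
  rw [← phd_zero, (phd_deriv 0 t).deriv]
  have h0 : phd 1 0 = 0 := by
    have := phd_neg 1 0
    simp at this
    linarith
  have := uu_anti ht
  simp only [uu, zero_add, h0, zero_div] at this ⊢
  exact (div_neg_iff.1 this).resolve_left (fun h => absurd h.2 (phd0_pos t).le.not_gt) |>.1

lemma phi_log (t : ℝ) : iteratedDeriv 2 (fun u => Real.log (jacobiPhi u)) t < 0 := by
  have h1 : deriv (fun u => Real.log (jacobiPhi u)) = uu := by
    funext t
    rw [← phd_zero]
    exact ((phd_deriv 0 t).log (phd0_pos t).ne').deriv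
  rw [iteratedDeriv_succ, iteratedDeriv_one, h1, (uu_deriv t).deriv]
  exact uu_deriv_neg t

lemma bigO_of {f : ℝ → ℝ} {C : ℝ} (h : ∀ t, |f t| ≤ C * exp (-|t| ^ 3)) :
    f =O[Filter.cocompact ℝ] fun t => Real.exp (-|t| ^ ((2 : ℝ) + 1)) := by
  refine Asymptotics.IsBigO.of_bound C (Filter.Eventually.of_forall fun t => ?_)
  rw [Real.norm_eq_abs, Real.norm_eq_abs, abs_of_pos (exp_pos _)]
  rw [show (2 : ℝ) + 1 = ((3 : ℕ) : ℝ) by norm_num, Real.rpow_natCast]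
  exact h t

lemma phi_adm : AdmissibleKernel jacobiPhi := by
  refine ⟨by rw [phi_eq]; exact FF_contDiff _, phi_pos, phi_even, fun t ht => phi_deriv_neg ht,
    1, one_pos, fun n => ?_⟩
  obtain ⟨C, _, h⟩ := phd_bound n
  rw [phd_iter]
  exact bigO_of h

noncomputable def gg (i j n : ℕ) (t s : ℝ) : ℝ := phd i (s + t) * phd j (s - t) * s ^ (2 * n)

noncomputable def GG (i j n : ℕ) (t : ℝ) : ℝ := ∫ s : ℝ, gg i j n t s

lemma gg_cont (i j n : ℕ) (t : ℝ) : Continuous (gg i j n t) := by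
  have h1 := phd_cont i
  have h2 := phd_cont j
  unfold gg
  fun_prop

lemma cube_ineq (s t : ℝ) : |s| ^ 3 + |t| ^ 3 ≤ |s + t| ^ 3 + |s - t| ^ 3 := by
  have hs := abs_nonneg s
  have ht := abs_nonneg t
  have a1 : 0 ≤ |s + t| ^ 3 := by positivity
  have a2 : 0 ≤ |s - t| ^ 3 := by positivity
  have h : |s| ^ 3 + |t| ^ 3 ≤ (|s| + |t|) ^ 3 := by
    nlinarith [mul_nonneg hs (sq_nonneg |t|), mul_nonneg ht (sq_nonneg |s|)]
  have h2 : |s| + |t| = |s + t| ∨ |s| + |t| = |s - t| := by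
    rcases le_total 0 s with h | h <;> rcases le_total 0 t with h' | h'
    · left; rw [abs_of_nonneg h, abs_of_nonneg h', abs_of_nonneg (by linarith)]
    · right; rw [abs_of_nonneg h, abs_of_nonpos h', abs_of_nonneg (by linarith)]; ring
    · right; rw [abs_of_nonpos h, abs_of_nonneg h', abs_of_nonpos (by linarith)]; ring
    · left; rw [abs_of_nonpos h, abs_of_nonpos h', abs_of_nonpos (by linarith)]; ring
  rcases h2 with h2 | h2 <;> rw [h2] at h <;> linarith

lemma gg_bound (i j n : ℕ) : ∃ C : ℝ, 0 ≤ C ∧ ∀ t s,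
    |gg i j n t s| ≤ C * exp (-|t| ^ 3) * exp (-(1 / 2) * s ^ 2) := by
  obtain ⟨C, hC, h1⟩ := phd_bound i
  obtain ⟨D, hD, h2⟩ := phd_bound j
  refine ⟨C * D * (2 ^ n * n.factorial * exp 1), by positivity, fun t s => ?_⟩
  have h3 : s ^ (2 * n) ≤ 2 ^ n * n.factorial * exp (s ^ 2 / 2) := by
    have h := Real.pow_div_factorial_le_exp (s ^ 2 / 2) (by positivity) n
    rw [div_le_iff₀ (by positivity), div_pow, div_le_iff₀ (by positivity), ← pow_mul] at h
    linarith
  have h4 : 0 ≤ s ^ (2 * n) := by rw [pow_mul]; positivity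
  have h5 : -|s + t| ^ 3 + -|s - t| ^ 3 + s ^ 2 / 2 ≤ 1 + -|t| ^ 3 + -(1 / 2) * s ^ 2 := by
    have h6 := cube_ineq s t
    have h7 : s ^ 2 ≤ 1 + |s| ^ 3 := by
      rw [← sq_abs]
      rcases le_total |s| 1 with h | h
      · nlinarith [abs_nonneg s, pow_nonneg (abs_nonneg s) 3]
      · nlinarith [mul_nonneg (sq_nonneg |s|) (sub_nonneg.2 h)]
    linarith
  unfold gg
  rw [abs_mul, abs_mul, abs_of_nonneg h4]
  calc |phd i (s + t)| * |phd j (s - t)| * s ^ (2 * n)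
      ≤ (C * exp (-|s + t| ^ 3)) * (D * exp (-|s - t| ^ 3)) *
          (2 ^ n * n.factorial * exp (s ^ 2 / 2)) := by
        gcongr
        · exact h1 _
        · exact h2 _
    _ = C * D * (2 ^ n * n.factorial) * exp (-|s + t| ^ 3 + -|s - t| ^ 3 + s ^ 2 / 2) := by
        rw [exp_add, exp_add]; ring
    _ ≤ C * D * (2 ^ n * n.factorial) * exp (1 + -|t| ^ 3 + -(1 / 2) * s ^ 2) := by
        gcongr
    _ = _ := by rw [exp_add, exp_add]; ring

lemma gauss_int : MeasureTheory.Integrable (fun s : ℝ => exp (-(1 / 2) * s ^ 2)) :=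
  integrable_exp_neg_mul_sq (by norm_num)

lemma gg_int (i j n : ℕ) (t : ℝ) : MeasureTheory.Integrable (gg i j n t) := by
  obtain ⟨C, hC, h⟩ := gg_bound i j n
  exact (gauss_int.const_mul _).mono' (gg_cont i j n t).aestronglyMeasurable
    (Filter.Eventually.of_forall fun s => h t s)

lemma GG_bound (i j n : ℕ) : ∃ C : ℝ, ∀ t, |GG i j n t| ≤ C * exp (-|t| ^ 3) := by
  obtain ⟨C, hC, h⟩ := gg_bound i j n
  refine ⟨C * ∫ s : ℝ, exp (-(1 / 2) * s ^ 2), fun t => ?_⟩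
  have := MeasureTheory.norm_integral_le_of_norm_le (f := gg i j n t)
    (gauss_int.const_mul (C * exp (-|t| ^ 3))) (Filter.Eventually.of_forall fun s => h t s)
  rw [MeasureTheory.integral_const_mul, Real.norm_eq_abs] at this
  unfold GG
  linarith

lemma gg_deriv (i j n : ℕ) (t s : ℝ) :
    HasDerivAt (fun t => gg i j n t s) (gg (i + 1) j n t s - gg i (j + 1) n t s) t := by
  have h1 := (phd_deriv i (s + t)).comp t ((hasDerivAt_id t).const_add s)
  have h2 := (phd_deriv j (s - t)).comp t ((hasDerivAt_id t).const_sub s)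
  refine ((h1.mul h2).mul_const (s ^ (2 * n))).congr_deriv ?_
  simp only [gg, Function.comp]
  ring

lemma GG_deriv (i j n : ℕ) (t : ℝ) :
    HasDerivAt (GG i j n) (GG (i + 1) j n t - GG i (j + 1) n t) t := by
  obtain ⟨C, hC, h1⟩ := gg_bound (i + 1) j n
  obtain ⟨D, hD, h2⟩ := gg_bound i (j + 1) n
  have := (hasDerivAt_integral_of_dominated_loc_of_deriv_le (𝕜 := ℝ)
    (μ := MeasureTheory.volume) (F := gg i j n) (x₀ := t) (s := Set.univ)
    (bound := fun s => (C + D) * exp (-(1 / 2) * s ^ 2))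
    (F' := fun t s => gg (i + 1) j n t s - gg i (j + 1) n t s) Filter.univ_mem
    (Filter.Eventually.of_forall fun x => (gg_cont i j n x).aestronglyMeasurable)
    (gg_int i j n t)
    ((gg_cont (i + 1) j n t).sub (gg_cont i (j + 1) n t)).aestronglyMeasurable
    (Filter.Eventually.of_forall fun s x _ => ?_) (gauss_int.const_mul _)
    (Filter.Eventually.of_forall fun s x _ => gg_deriv i j n x s)).2
  · rw [MeasureTheory.integral_sub (gg_int _ _ _ _) (gg_int _ _ _ _)] at this
    exact this
  · have e : exp (-|x| ^ 3) ≤ 1 := by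
      rw [exp_le_one_iff]; have : 0 ≤ |x| ^ 3 := by positivity
      linarith
    have a1 := h1 x s
    have a2 := h2 x s
    have g := exp_pos (-(1 / 2) * s ^ 2)
    have b1 : C * exp (-|x| ^ 3) * exp (-(1 / 2) * s ^ 2) ≤ C * 1 * exp (-(1 / 2) * s ^ 2) := by
      gcongr
    have b2 : D * exp (-|x| ^ 3) * exp (-(1 / 2) * s ^ 2) ≤ D * 1 * exp (-(1 / 2) * s ^ 2) := by
      gcongr
    rw [Real.norm_eq_abs]
    refine (abs_sub _ _).trans ?_
    linarith

lemma GG_deriv_eq (i j n : ℕ) : deriv (GG i j n) = GG (i + 1) j n - GG i (j + 1) n :=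
  funext fun t => (GG_deriv i j n t).deriv

lemma GG_contDiff (i j n k : ℕ) : ContDiff ℝ k (GG i j n) := by
  induction k generalizing i j with
  | zero =>
    exact contDiff_zero.2 (continuous_iff_continuousAt.2 fun t => (GG_deriv i j n t).continuousAt)
  | succ k ih =>
    push_cast
    refine contDiff_succ_iff_deriv.2 ⟨fun t => (GG_deriv i j n t).differentiableAt, by simp, ?_⟩
    rw [GG_deriv_eq]
    exact (ih _ _).sub (ih _ _)

lemma GG_bigO (i j n k : ℕ) : (iteratedDeriv k (GG i j n)) =O[Filter.cocompact ℝ]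
    fun t => Real.exp (-|t| ^ ((2 : ℝ) + 1)) := by
  induction k generalizing i j with
  | zero =>
    obtain ⟨C, h⟩ := GG_bound i j n
    rw [iteratedDeriv_zero]
    exact bigO_of h
  | succ k ih =>
    rw [iteratedDeriv_succ', GG_deriv_eq]
    have : iteratedDeriv k (GG (i + 1) j n - GG i (j + 1) n) =
        fun t => iteratedDeriv k (GG (i + 1) j n) t - iteratedDeriv k (GG i (j + 1) n) t :=
      funext fun t => iteratedDeriv_sub (GG_contDiff _ _ _ _).contDiffAt (GG_contDiff _ _ _ _).contDiffAt
    rw [this]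
    exact (ih _ _).sub (ih _ _)

lemma assoc_eq (n : ℕ) : assocKernelPhi n = GG 0 0 n := by
  funext t
  simp only [assocKernelPhi, GG, gg, phd_zero]

lemma assoc_adm (n : ℕ) : AdmissibleKernel (assocKernelPhi n) := by
  have hsq : ∀ s : ℝ, 0 ≤ s ^ (2 * n) := fun s => by rw [pow_mul]; positivity
  refine ⟨?_, fun t => ?_, fun t => ?_, fun t ht => ?_, 1, one_pos, fun k => ?_⟩
  · rw [assoc_eq, contDiff_infty]
    exact GG_contDiff 0 0 n
  · rw [assoc_eq]
    refine MeasureTheory.integral_pos_of_integrable_nonneg_nonzero (x := 1) (gg_cont 0 0 n t)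
      (gg_int 0 0 n t) (fun s => ?_) ?_
    · exact mul_nonneg (mul_pos (phd0_pos _) (phd0_pos _)).le (hsq s)
    · simp only [gg, one_pow, mul_one]
      exact (mul_pos (phd0_pos _) (phd0_pos _)).ne'
  · unfold assocKernelPhi
    congr 1
    funext s
    rw [sub_neg_eq_add, ← sub_eq_add_neg]
    ring
  · rw [assoc_eq, (GG_deriv 0 0 n t).deriv]
    have key : ∀ s : ℝ, 0 < phd 0 (s + t) * phd 1 (s - t) - phd 1 (s + t) * phd 0 (s - t) := by
      intro s
      have := uu_anti (show s - t < s + t by linarith)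
      unfold uu at this
      rw [div_lt_div_iff₀ (phd0_pos _) (phd0_pos _)] at this
      linarith
    have : 0 < ∫ s, (gg 0 1 n t s - gg 1 0 n t s) := by
      refine MeasureTheory.integral_pos_of_integrable_nonneg_nonzero (x := 1)
        ((gg_cont 0 1 n t).sub (gg_cont 1 0 n t))
        ((gg_int 0 1 n t).sub (gg_int 1 0 n t)) (fun s => ?_) ?_
      · have := mul_nonneg (key s).le (hsq s)
        simp only [gg, Pi.zero_apply]
        linarith
      · simp only [gg, one_pow, mul_one]
        exact (key 1).ne'
    rw [MeasureTheory.integral_sub (gg_int _ _ _ _) (gg_int _ _ _ _)] at this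
    simp only [GG, zero_add]
    linarith
  · rw [assoc_eq]
    exact GG_bigO 0 0 n k

end JPhi

/-- **Theorem 4.5.** The Jacobi theta kernel `Φ` is a strictly logarithmically concave
admissible kernel, and for each `n ∈ ℕ₀` the associated kernel
`Kₙ(t; Φ) = ∫ Φ(s+t)·Φ(s−t)·s^{2n} ds` is also an admissible kernel. -/
theorem thm_4_5 :
    AdmissibleKernel jacobiPhi ∧
    (∀ t : ℝ, 0 < t → iteratedDeriv 2 (fun u => Real.log (jacobiPhi u)) t < 0) ∧
    (∀ n : ℕ, AdmissibleKernel (assocKernelPhi n)) := by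
  exact ⟨JPhi.phi_adm, fun t _ => JPhi.phi_log t, JPhi.assoc_adm⟩
end
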